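/- arXiv:2406.12461 — 2 statements merged into one kernel-verified Lean document; each statement's English description precedes it below -/
import Mathlib

section
/- Let d ≥ 1, L > 0, μ ≥ 0, let G be a lattice in ℝ^d with d(G) = L^d, let D ⊆ ℝ^d be a fundamental domain for G, and let 𝑣 = (v_1,…,v_N) be a volume vector with ∑_i v_i = L^d. Consider f_μ(D,𝑣) := inf{ μ·Per_K(D) + (1/2)·∑_{i=1}^N Per_K(E_i) : E_i ⊆ D Borel, |E_i| = v_i for all i, |E_i ∩ E_j| = 0 for i ≠ j, |D ∖ ⋃_i E_i| = 0 }, where Per_K is the nonlocal perimeter. If f_μ(D,𝑣) is finite, then there exists a minimizing partition (E_1,…,E_N) of D attaining f_μ(D,𝑣). -/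
open MeasureTheory Filter Topology
open scoped symmDiff ENNReal

noncomputable section

variable {d : ℕ}

abbrev Vd (d : ℕ) := EuclideanSpace ℝ (Fin d)

def nlPer (K : Vd d → ℝ≥0∞) (E : Set (Vd d)) : ℝ≥0∞ :=
  ∫⁻ x in E, ∫⁻ y in Eᶜ, K (x - y)

def nlPerRel (K : Vd d → ℝ≥0∞) (E Ω : Set (Vd d)) : ℝ≥0∞ :=
  (∫⁻ x in E ∩ Ω, ∫⁻ y in Eᶜ, K (x - y)) + (∫⁻ x in E \ Ω, ∫⁻ y in Ω \ E, K (x - y))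

def IsKernelBase (K : Vd d → ℝ≥0∞) : Prop :=
  Measurable K ∧ (∀ x, K (-x) = K x) ∧ (∫⁻ x, ENNReal.ofReal (min 1 ‖x‖) * K x) < ⊤

def IsKernel (s C : ℝ) (K : Vd d → ℝ≥0∞) : Prop :=
  IsKernelBase K ∧ ∀ x : Vd d, x ≠ 0 → ENNReal.ofReal (C * ‖x‖ ^ (-(d : ℝ) - s)) ≤ K x

def latticeOf (b : Fin d → Vd d) : Set (Vd d) :=
  {x | ∃ k : Fin d → ℤ, x = ∑ i, (k i : ℝ) • b i}

def IsLattice (G : Set (Vd d)) : Prop :=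
  ∃ b : Fin d → Vd d, LinearIndependent ℝ b ∧ G = latticeOf b

def IsLatticeWithVol (G : Set (Vd d)) (vol : ℝ) : Prop :=
  ∃ b : Fin d → Vd d, LinearIndependent ℝ b ∧ G = latticeOf b ∧
    |Matrix.det (Matrix.of fun i j => b j i)| = vol

def setTranslate (g : Vd d) (A : Set (Vd d)) : Set (Vd d) := (fun x => x + g) '' A

def IsFundDom (G : Set (Vd d)) (D : Set (Vd d)) : Prop :=
  MeasurableSet D ∧ (∀ g ∈ G, g ≠ 0 → volume (setTranslate g D ∩ D) = 0) ∧
    volume (Set.univ \ ⋃ g ∈ G, setTranslate g D) = 0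

def packingRadius (G : Set (Vd d)) : ℝ :=
  sSup {r : ℝ | 0 < r ∧ ∀ g₁ ∈ G, ∀ g₂ ∈ G, g₁ ≠ g₂ →
    Disjoint (Metric.ball g₁ r) (Metric.ball g₂ r)}

def phiK (K : Vd d → ℝ≥0∞) (t : ℝ) : ℝ≥0∞ := ∫⁻ x in (Metric.ball (0 : Vd d) t)ᶜ, K x

def setDist (A B : Set (Vd d)) : ℝ := sInf ((fun p : Vd d × Vd d => dist p.1 p.2) '' (A ×ˢ B))

def TendstoL1loc (E : ℕ → Set (Vd d)) (F : Set (Vd d)) : Prop :=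
  ∀ R : ℝ, 0 < R → Tendsto (fun n => volume ((E n ∆ F) ∩ Metric.ball 0 R)) atTop (𝓝 0)

def AdmissiblePart (D : Set (Vd d)) {N : ℕ} (v : Fin N → ℝ) (E : Fin N → Set (Vd d)) : Prop :=
  (∀ i, MeasurableSet (E i)) ∧ (∀ i, E i ⊆ D) ∧
  (∀ i, volume (E i) = ENNReal.ofReal (v i)) ∧
  (∀ i j, i ≠ j → volume (E i ∩ E j) = 0) ∧
  volume (D \ ⋃ i, E i) = 0

def AdmissiblePart₀ (D : Set (Vd d)) {N : ℕ} (E : Fin N → Set (Vd d)) : Prop :=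
  (∀ i, MeasurableSet (E i)) ∧ (∀ i, E i ⊆ D) ∧
  (∀ i j, i ≠ j → volume (E i ∩ E j) = 0) ∧
  volume (D \ ⋃ i, E i) = 0

def ediff (a b : ℝ≥0∞) : ℝ≥0∞ := (a - b) + (b - a)

def IsPartition {J : Type*} (A : J → Set (Vd d)) : Prop :=
  (∀ j, MeasurableSet (A j)) ∧ (∀ j j', j ≠ j' → volume (A j ∩ A j') = 0) ∧
  volume (Set.univ \ ⋃ j, A j) = 0

def ComptContained (S Ω : Set (Vd d)) : Prop := IsCompact (closure S) ∧ closure S ⊆ Ω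

def IsVolConstrMin (K : Vd d → ℝ≥0∞) (Λ : ℝ≥0∞) (Ω : Set (Vd d))
    {J : Type*} (A : J → Set (Vd d)) : Prop :=
  (∑' j, nlPerRel K (A j) Ω) ≠ ⊤ ∧
  ∀ B : J → Set (Vd d), IsPartition B →
    (∀ j, ComptContained (A j ∆ B j) Ω) →
    (∀ j, volume (A j ∩ Ω) = volume (B j ∩ Ω)) →
    (∑' j, nlPerRel K (A j) Ω) ≤ ∑' j, (nlPerRel K (B j) Ω + Λ * volume (A j ∆ B j))

def IsLamMin (K : Vd d → ℝ≥0∞) (Λ : ℝ≥0∞) (Ω : Set (Vd d))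
    {J : Type*} (A : J → Set (Vd d)) : Prop :=
  (∑' j, nlPerRel K (A j) Ω) ≠ ⊤ ∧
  ∀ B : J → Set (Vd d), IsPartition B →
    (∀ j, ComptContained (A j ∆ B j) Ω) →
    (∑' j, nlPerRel K (A j) Ω) ≤ ∑' j, (nlPerRel K (B j) Ω + Λ * volume (A j ∆ B j))

/-- Convergence of integrals against every bounded measurable function. -/
def TendstoWeakly {X : Type*} [MeasurableSpace X] (ν : Measure X) (u : ℕ → X → ℝ)
    (f : X → ℝ) : Prop :=
  ∀ g : X → ℝ, Measurable g → (∃ B, ∀ x, |g x| ≤ B) →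
    Tendsto (fun n => ∫ x, g x * u n x ∂ν) atTop (𝓝 (∫ x, g x * f x ∂ν))

theorem TendstoWeakly.comp {X : Type*} [MeasurableSpace X] {ν : Measure X} {u : ℕ → X → ℝ}
    {f : X → ℝ} (h : TendstoWeakly ν u f) {φ : ℕ → ℕ} (hφ : StrictMono φ) :
    TendstoWeakly ν (fun n => u (φ n)) f :=
  fun g hg hB => (h g hg hB).comp hφ.tendsto_atTop

theorem integrable_of_bdd {X : Type*} [MeasurableSpace X] {ν : Measure X} [IsFiniteMeasure ν]
    {g : X → ℝ} (hg : Measurable g) {B : ℝ} (hB : ∀ x, |g x| ≤ B) : Integrable g ν :=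
  Integrable.of_bound hg.aestronglyMeasurable B (Eventually.of_forall hB)

/-- Weak sequential compactness of the set of measurable `[0, 1]`-valued functions. -/
theorem exists_subseq_tendstoWeakly {X : Type*} [MeasurableSpace X]
    [MeasurableSpace.CountablyGenerated X] (ν : Measure X) [IsFiniteMeasure ν]
    (u : ℕ → X → ℝ) (hu : ∀ n, Measurable (u n)) (hu01 : ∀ n x, u n x ∈ Set.Icc (0 : ℝ) 1) :
    ∃ φ : ℕ → ℕ, StrictMono φ ∧ ∃ f : X → ℝ, Measurable f ∧ (∀ x, f x ∈ Set.Icc (0 : ℝ) 1) ∧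
      TendstoWeakly ν (fun n => u (φ n)) f := by
  have habs : ∀ n x, |u n x| ≤ 1 := fun n x => by
    rw [abs_of_nonneg (hu01 n x).1]; exact (hu01 n x).2
  have hmem : ∀ n, MemLp (u n) 2 ν := fun n =>
    MemLp.of_bound (hu n).aestronglyMeasurable 1 (Eventually.of_forall (habs n))
  let U : ℕ → Lp ℝ 2 ν := fun n => (hmem n).toLp (u n)
  have : Fact ((1 : ℝ≥0∞) ≤ 2) := ⟨by norm_num⟩
  have : Fact ((2 : ℝ≥0∞) ≠ ⊤) := ⟨by norm_num⟩
  obtain ⟨R, hR⟩ : ∃ R, ∀ n, ‖U n‖ ≤ R := by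
    refine ⟨(ν Set.univ).toReal ^ (2 : ℝ≥0∞).toReal⁻¹ * 1, fun n => ?_⟩
    refine Lp.norm_le_of_ae_bound (by norm_num) ?_
    filter_upwards [(hmem n).coeFn_toLp] with x hx
    rw [hx]; exact habs n x
  let Φ : ℕ → WeakDual ℝ (Lp ℝ 2 ν) := fun n =>
    StrongDual.toWeakDual (InnerProductSpace.toDual ℝ (Lp ℝ 2 ν) (U n))
  have hΦ : ∀ n, Φ n ∈ WeakDual.toStrongDual ⁻¹'
      Metric.closedBall (0 : StrongDual ℝ (Lp ℝ 2 ν)) R := by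
    intro n
    simp only [Set.mem_preimage, mem_closedBall_zero_iff]
    change ‖InnerProductSpace.toDual ℝ (Lp ℝ 2 ν) (U n)‖ ≤ R
    rw [LinearIsometryEquiv.norm_map]; exact hR n
  obtain ⟨a, -, φ, hφ, hlim⟩ :=
    WeakDual.isSeqCompact_closedBall ℝ (Lp ℝ 2 ν) (0 : StrongDual ℝ (Lp ℝ 2 ν)) R hΦ
  let F : Lp ℝ 2 ν := (InnerProductSpace.toDual ℝ (Lp ℝ 2 ν)).symm (WeakDual.toStrongDual a)
  have hFa : ∀ g, a g = inner ℝ F g := fun g => by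
    rw [InnerProductSpace.toDual_symm_apply]; rfl
  have hF1 : Integrable F ν := (Lp.memLp F).integrable (by norm_num)
  have hweak : ∀ g : X → ℝ, Measurable g → (∃ B, ∀ x, |g x| ≤ B) →
      Tendsto (fun n => ∫ x, g x * u (φ n) x ∂ν) atTop (𝓝 (∫ x, g x * F x ∂ν)) := by
    rintro g hg ⟨B, hB⟩
    have hgm : MemLp g 2 ν :=
      MemLp.of_bound hg.aestronglyMeasurable B (Eventually.of_forall hB)
    have h1 := ((WeakDual.eval_continuous (hgm.toLp g)).tendsto a).comp hlim
    rw [hFa] at h1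
    have e1 : inner ℝ F (hgm.toLp g) = ∫ x, g x * F x ∂ν := by
      rw [L2.inner_def]
      refine integral_congr_ae ?_
      filter_upwards [hgm.coeFn_toLp] with x hx
      simp [hx]
    rw [e1] at h1
    refine h1.congr fun n => ?_
    change inner ℝ (U (φ n)) (hgm.toLp g) = _
    rw [L2.inner_def]
    refine integral_congr_ae ?_
    filter_upwards [hgm.coeFn_toLp, (hmem (φ n)).coeFn_toLp] with x hx hx'
    simp only [U]
    rw [hx, hx']
    simp [mul_comm]
  have hset : ∀ s : Set X, MeasurableSet s →
      Tendsto (fun n => ∫ x in s, u (φ n) x ∂ν) atTop (𝓝 (∫ x in s, F x ∂ν)) := by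
    intro s hs
    have := hweak (s.indicator 1) (measurable_one.indicator hs) ⟨1, fun x => by
      by_cases h : x ∈ s <;> simp [h]⟩
    have e : ∀ w : X → ℝ, ∫ x, s.indicator 1 x * w x ∂ν = ∫ x in s, w x ∂ν := fun w => by
      rw [← integral_indicator hs]
      congr 1; ext x; by_cases h : x ∈ s <;> simp [h]
    simpa only [e] using this
  have hF0 : 0 ≤ᵐ[ν] F := ae_nonneg_of_forall_setIntegral_nonneg hF1 fun s hs _ =>
    ge_of_tendsto' (hset s hs) fun n => integral_nonneg fun x => (hu01 _ x).1
  have hFle : F ≤ᵐ[ν] fun _ => (1 : ℝ) := ae_le_of_forall_setIntegral_le hF1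
    (integrable_const _) fun s hs _ =>
    le_of_tendsto' (hset s hs) fun n => integral_mono
      (integrable_of_bdd (hu _) (habs _)) (integrable_const _) fun x => (hu01 _ x).2
  let F' : X → ℝ := (Lp.aestronglyMeasurable F).mk F
  have hF'm : Measurable F' := (Lp.aestronglyMeasurable F).stronglyMeasurable_mk.measurable
  have hF' : F =ᵐ[ν] F' := (Lp.aestronglyMeasurable F).ae_eq_mk
  refine ⟨φ, hφ, fun x => max 0 (min (F' x) 1), measurable_const.max (hF'm.min measurable_const),
    fun x => ⟨le_max_left _ _, max_le zero_le_one (min_le_right _ _)⟩, fun g hg hB => ?_⟩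
  have : ∫ x, g x * max 0 (min (F' x) 1) ∂ν = ∫ x, g x * F x ∂ν := by
    refine integral_congr_ae ?_
    filter_upwards [hF', hF0, hFle] with x h1 h2 h3
    rw [← h1, min_eq_left h3]
    exact congrArg _ (max_eq_right h2)
  rw [this]
  exact hweak g hg hB

/-- A finite family of sequences has a common weakly convergent subsequence. -/
theorem exists_subseq_forall_tendstoWeakly {X : Type*} [MeasurableSpace X]
    [MeasurableSpace.CountablyGenerated X] (ν : Measure X) [IsFiniteMeasure ν]
    {ι : Type*} [Finite ι] (u : ι → ℕ → X → ℝ) (hu : ∀ i n, Measurable (u i n))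
    (hu01 : ∀ i n x, u i n x ∈ Set.Icc (0 : ℝ) 1) :
    ∃ φ : ℕ → ℕ, StrictMono φ ∧ ∃ f : ι → X → ℝ, (∀ i, Measurable (f i)) ∧
      (∀ i x, f i x ∈ Set.Icc (0 : ℝ) 1) ∧ ∀ i, TendstoWeakly ν (fun n => u i (φ n)) (f i) := by
  suffices H : ∀ S : Set ι, S.Finite → ∃ φ : ℕ → ℕ, StrictMono φ ∧ ∀ i ∈ S, ∃ f : X → ℝ,
      Measurable f ∧ (∀ x, f x ∈ Set.Icc (0 : ℝ) 1) ∧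
      TendstoWeakly ν (fun n => u i (φ n)) f by
    obtain ⟨φ, hφ, h⟩ := H Set.univ Set.finite_univ
    choose f h1 h2 h3 using fun i => h i (Set.mem_univ i)
    exact ⟨φ, hφ, f, h1, h2, h3⟩
  intro S hS
  induction S, hS using Set.Finite.induction_on with
  | empty => exact ⟨id, strictMono_id, by simp⟩
  | @insert a S _ _ ih =>
    obtain ⟨φ, hφ, h⟩ := ih
    obtain ⟨ψ, hψ, f, hf, hf01, hw⟩ := exists_subseq_tendstoWeakly ν (fun n => u a (φ n))
      (fun n => hu a _) fun n => hu01 a _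
    refine ⟨φ ∘ ψ, hφ.comp hψ, fun i hi => ?_⟩
    rcases hi with rfl | hi
    · exact ⟨f, hf, hf01, hw⟩
    · obtain ⟨f', h1, h2, h3⟩ := h i hi
      exact ⟨f', h1, h2, h3.comp hψ⟩

/-- Continuity of a bounded quadratic form under weak convergence. -/
theorem TendstoWeakly.tendsto_quadratic {X : Type*} [MeasurableSpace X] {ν : Measure X}
    [IsFiniteMeasure ν] {u : ℕ → X → ℝ} {f : X → ℝ} (hu : ∀ n, Measurable (u n))
    (hu01 : ∀ n x, u n x ∈ Set.Icc (0 : ℝ) 1) (hf : Measurable f)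
    (hf01 : ∀ x, f x ∈ Set.Icc (0 : ℝ) 1) (h : TendstoWeakly ν u f)
    {k : X → X → ℝ} (hk : Measurable (Function.uncurry k)) {B : ℝ} (hB : ∀ x y, |k x y| ≤ B) :
    Tendsto (fun n => ∫ x, (∫ y, k x y * u n y ∂ν) * u n x ∂ν) atTop
      (𝓝 (∫ x, (∫ y, k x y * f y ∂ν) * f x ∂ν)) := by
  have hmeas : ∀ w : X → ℝ, Measurable w → Measurable fun x => ∫ y, k x y * w y ∂ν := by
    intro w hw
    have : Measurable fun p : X × X => k p.1 p.2 * w p.2 := hk.mul (hw.comp measurable_snd)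
    exact this.stronglyMeasurable.integral_prod_right'.measurable
  have hbd : ∀ w : X → ℝ, Measurable w → (∀ x, w x ∈ Set.Icc (0 : ℝ) 1) →
      ∀ x, |∫ y, k x y * w y ∂ν| ≤ B * ν.real Set.univ := by
    intro w hw hw01 x
    rw [← Real.norm_eq_abs]
    refine norm_integral_le_of_norm_le_const (Eventually.of_forall fun y => ?_)
    rw [Real.norm_eq_abs, abs_mul, abs_of_nonneg (hw01 y).1]
    calc |k x y| * w y ≤ |k x y| * 1 := mul_le_mul_of_nonneg_left (hw01 y).2 (abs_nonneg _)
      _ ≤ B := by simpa using hB x y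
  have hpt : ∀ x, Tendsto (fun n => ∫ y, k x y * u n y ∂ν) atTop (𝓝 (∫ y, k x y * f y ∂ν)) :=
    fun x => h (k x) (hk.comp measurable_prodMk_left) ⟨B, hB x⟩
  have h1 : Tendsto (fun n => ∫ x, ((∫ y, k x y * u n y ∂ν) - ∫ y, k x y * f y ∂ν) * u n x ∂ν)
      atTop (𝓝 0) := by
    have := tendsto_integral_of_dominated_convergence (μ := ν)
      (F := fun n x => ((∫ y, k x y * u n y ∂ν) - ∫ y, k x y * f y ∂ν) * u n x)
      (f := fun _ => 0) (fun _ => B * ν.real Set.univ + B * ν.real Set.univ)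
      (fun n => (((hmeas _ (hu n)).sub (hmeas _ hf)).mul (hu n)).aestronglyMeasurable)
      (integrable_const _) (fun n => Eventually.of_forall fun x => ?_)
      (Eventually.of_forall fun x => ?_)
    · simpa using this
    · rw [Real.norm_eq_abs, abs_mul, abs_of_nonneg (hu01 n x).1]
      calc _ ≤ |(∫ y, k x y * u n y ∂ν) - ∫ y, k x y * f y ∂ν| * 1 :=
            mul_le_mul_of_nonneg_left (hu01 n x).2 (abs_nonneg _)
        _ ≤ _ := by
            rw [mul_one]
            exact (abs_sub _ _).trans (add_le_add (hbd _ (hu n) (hu01 n) x) (hbd _ hf hf01 x))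
    · refine squeeze_zero_norm (fun n => ?_)
        (tendsto_zero_iff_norm_tendsto_zero.1 (tendsto_sub_nhds_zero_iff.2 (hpt x)))
      rw [norm_mul]
      refine mul_le_of_le_one_right (norm_nonneg _) ?_
      rw [Real.norm_eq_abs, abs_of_nonneg (hu01 n x).1]; exact (hu01 n x).2
  have h2 := h1.add (h _ (hmeas f hf) ⟨_, hbd f hf hf01⟩)
  rw [zero_add] at h2
  refine h2.congr fun n => ?_
  have hi : ∀ w w' : X → ℝ, Measurable w → (∀ x, w x ∈ Set.Icc (0 : ℝ) 1) → Measurable w' →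
      (∀ x, w' x ∈ Set.Icc (0 : ℝ) 1) → Integrable (fun x => (∫ y, k x y * w y ∂ν) * w' x) ν := by
    intro w w' hw hw01 hw' hw01'
    refine integrable_of_bdd (ν := ν) (g := fun x => (∫ y, k x y * w y ∂ν) * w' x)
      ((hmeas w hw).mul hw') (B := B * ν.real Set.univ) fun x => ?_
    rw [abs_mul, abs_of_nonneg (hw01' x).1]
    exact (mul_le_of_le_one_right (abs_nonneg _) (hw01' x).2).trans (hbd w hw hw01 x)
  simp only [sub_mul]
  rw [integral_sub (hi _ _ (hu n) (hu01 n) (hu n) (hu01 n)) (hi _ _ hf hf01 (hu n) (hu01 n))]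
  ring

/-- Schur's bound for the quadratic form of a symmetric nonnegative kernel. -/
theorem integral_quadratic_le {X : Type*} [MeasurableSpace X] {ν : Measure X}
    [IsFiniteMeasure ν] {f : X → ℝ} (hf : Measurable f) (hf01 : ∀ x, f x ∈ Set.Icc (0 : ℝ) 1)
    {k : X → X → ℝ} (hk : Measurable (Function.uncurry k)) {B : ℝ}
    (hB : ∀ x y, k x y ∈ Set.Icc 0 B) (hsymm : ∀ x y, k x y = k y x) {κ : ℝ}
    (hκ : ∀ x, ∫ y, k x y ∂ν ≤ κ) :
    ∫ x, (∫ y, k x y * f y ∂ν) * f x ∂ν ≤ κ * ∫ x, f x ^ 2 ∂ν := by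
  have hint : ∀ w : X × X → ℝ, Measurable w → (∀ p, w p ∈ Set.Icc (0 : ℝ) 1) →
      Integrable (fun p : X × X => k p.1 p.2 * w p) (ν.prod ν) := by
    intro w hw hw01
    refine integrable_of_bdd (g := fun p : X × X => k p.1 p.2 * w p) (hk.mul hw) (B := B)
      fun p => ?_
    have h1 := hB p.1 p.2
    have h2 := hw01 p
    rw [abs_of_nonneg (mul_nonneg h1.1 h2.1)]
    exact (mul_le_of_le_one_right h1.1 h2.2).trans h1.2
  have hsq : ∀ x, f x ^ 2 ∈ Set.Icc (0 : ℝ) 1 := fun x =>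
    ⟨sq_nonneg _, pow_le_one₀ (hf01 x).1 (hf01 x).2⟩
  have i1 := hint (fun p => f p.1 ^ 2) ((hf.comp measurable_fst).pow_const 2) fun p => hsq _
  have i2 := hint (fun p => f p.2 ^ 2) ((hf.comp measurable_snd).pow_const 2) fun p => hsq _
  have i3 := hint (fun p => f p.2 * f p.1) ((hf.comp measurable_snd).mul (hf.comp measurable_fst))
    fun p => ⟨mul_nonneg (hf01 _).1 (hf01 _).1, mul_le_one₀ (hf01 _).2 (hf01 _).1 (hf01 _).2⟩
  have e1 : ∫ p : X × X, k p.1 p.2 * f p.1 ^ 2 ∂ν.prod ν ≤ κ * ∫ x, f x ^ 2 ∂ν := by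
    rw [integral_prod _ i1, ← integral_const_mul]
    refine integral_mono i1.integral_prod_left
      ((integrable_of_bdd (hf.pow_const 2) (B := 1) fun x => ?_).const_mul κ) fun x => ?_
    · rw [abs_of_nonneg (hsq x).1]; exact (hsq x).2
    · simp only [integral_mul_const]
      exact mul_le_mul_of_nonneg_right (hκ x) (hsq x).1
  have e2 : ∫ p : X × X, k p.1 p.2 * f p.2 ^ 2 ∂ν.prod ν =
      ∫ p : X × X, k p.1 p.2 * f p.1 ^ 2 ∂ν.prod ν := by
    rw [← integral_prod_swap]
    simp only [Prod.fst_swap, Prod.snd_swap]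
    simp only [hsymm]
  have e3 : ∫ x, (∫ y, k x y * f y ∂ν) * f x ∂ν =
      ∫ p : X × X, k p.1 p.2 * (f p.2 * f p.1) ∂ν.prod ν := by
    rw [integral_prod _ i3]
    simp only [← integral_mul_const, mul_assoc]
  have e4 : ∫ p : X × X, k p.1 p.2 * (f p.2 * f p.1) ∂ν.prod ν ≤
      ∫ p : X × X, 2⁻¹ * (k p.1 p.2 * f p.1 ^ 2 + k p.1 p.2 * f p.2 ^ 2) ∂ν.prod ν := by
    refine integral_mono i3 ((i1.add i2).const_mul _) fun p => ?_
    simp only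
    nlinarith [mul_nonneg (hB p.1 p.2).1 (sq_nonneg (f p.1 - f p.2))]
  rw [integral_const_mul, integral_add i1 i2, e2] at e4
  rw [e3]
  linarith

/-- The bounded, compactly supported truncation of a kernel at level `j`. -/
def truncKernel {d : ℕ} (K : Vd d → ℝ≥0∞) (j : ℕ) (x : Vd d) : ℝ :=
  (min ((Metric.ball (0 : Vd d) j).indicator K x) j).toReal

section truncKernel

variable {d : ℕ} {K : Vd d → ℝ≥0∞}

theorem measurable_truncKernel (hK : Measurable K) (j : ℕ) : Measurable (truncKernel K j) :=
  ((hK.indicator measurableSet_ball).min measurable_const).ennreal_toReal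

theorem truncKernel_mem_Icc (j : ℕ) (x : Vd d) : truncKernel K j x ∈ Set.Icc (0 : ℝ) j := by
  refine ⟨ENNReal.toReal_nonneg, ?_⟩
  have := ENNReal.toReal_mono (ENNReal.natCast_ne_top j) (min_le_right
    ((Metric.ball (0 : Vd d) j).indicator K x) (j : ℝ≥0∞))
  simpa [truncKernel] using this

theorem ofReal_truncKernel (j : ℕ) (x : Vd d) :
    ENNReal.ofReal (truncKernel K j x) = min ((Metric.ball (0 : Vd d) j).indicator K x) j :=
  ENNReal.ofReal_toReal (ne_top_of_le_ne_top (ENNReal.natCast_ne_top j) (min_le_right _ _))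

theorem truncKernel_neg (hK : ∀ x, K (-x) = K x) (j : ℕ) (x : Vd d) :
    truncKernel K j (-x) = truncKernel K j x := by
  simp [truncKernel, Set.indicator, hK]

theorem integrable_truncKernel (hK : Measurable K) (j : ℕ) : Integrable (truncKernel K j) := by
  have h : IntegrableOn (truncKernel K j) (Metric.ball (0 : Vd d) j) :=
    Measure.integrableOn_of_bounded measure_ball_lt_top.ne
      (measurable_truncKernel hK j).aestronglyMeasurable (M := j) (Eventually.of_forall fun x => by
        rw [Real.norm_eq_abs, abs_of_nonneg (truncKernel_mem_Icc j x).1]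
        exact (truncKernel_mem_Icc j x).2)
  refine (integrableOn_iff_integrable_of_support_subset fun x hx => ?_).1 h
  by_contra hx'
  exact hx (by simp [truncKernel, Set.indicator_of_notMem hx'])

theorem monotone_ofReal_truncKernel (x : Vd d) :
    Monotone fun j => ENNReal.ofReal (truncKernel K j x) := by
  intro i j hij
  simp only [ofReal_truncKernel]
  have h : (i : ℝ) ≤ j := by exact_mod_cast hij
  exact min_le_min (Set.indicator_le_indicator_of_subset (Metric.ball_subset_ball h)
    (fun _ => zero_le) x) (by exact_mod_cast hij)

theorem tendsto_ofReal_truncKernel (x : Vd d) :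
    Tendsto (fun j => ENNReal.ofReal (truncKernel K j x)) atTop (𝓝 (K x)) := by
  simp only [ofReal_truncKernel]
  have h1 : Tendsto (fun j : ℕ => (Metric.ball (0 : Vd d) j).indicator K x) atTop (𝓝 (K x)) := by
    refine tendsto_const_nhds.congr' ?_
    obtain ⟨n, hn⟩ := exists_nat_gt ‖x‖
    filter_upwards [eventually_ge_atTop n] with j hj
    have h : (n : ℝ) ≤ j := by exact_mod_cast hj
    rw [Set.indicator_of_mem]
    simpa using hn.trans_le h
  simpa using h1.min ENNReal.tendsto_nat_nhds_top

theorem tendsto_lintegral_truncKernel (hK : Measurable K) :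
    Tendsto (fun j => ∫⁻ x, ENNReal.ofReal (truncKernel K j x)) atTop (𝓝 (∫⁻ x, K x)) :=
  lintegral_tendsto_of_tendsto_of_monotone
    (fun j => (measurable_truncKernel hK j).ennreal_ofReal.aemeasurable)
    (Eventually.of_forall monotone_ofReal_truncKernel)
    (Eventually.of_forall tendsto_ofReal_truncKernel)

theorem tendsto_nlPer_truncKernel (hK : Measurable K) (A B : Set (Vd d)) :
    Tendsto (fun j => ∫⁻ x in A, ∫⁻ y in B, ENNReal.ofReal (truncKernel K j (x - y))) atTop
      (𝓝 (∫⁻ x in A, ∫⁻ y in B, K (x - y))) := by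
  have hm : ∀ j, Measurable fun p : Vd d × Vd d => ENNReal.ofReal (truncKernel K j (p.1 - p.2)) :=
    fun j => ((measurable_truncKernel hK j).comp
      (measurable_fst.sub measurable_snd)).ennreal_ofReal
  refine lintegral_tendsto_of_tendsto_of_monotone
    (fun j => (hm j).lintegral_prod_right'.aemeasurable)
    (Eventually.of_forall fun x i j hij => lintegral_mono fun y =>
      monotone_ofReal_truncKernel (x - y) hij)
    (Eventually.of_forall fun x => ?_)
  exact lintegral_tendsto_of_tendsto_of_monotone
    (fun j => ((hm j).comp measurable_prodMk_left).aemeasurable)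
    (Eventually.of_forall fun y => monotone_ofReal_truncKernel (x - y))
    (Eventually.of_forall fun y => tendsto_ofReal_truncKernel (x - y))

end truncKernel

/-- A kernel bounded below by a fractional kernel is not integrable. -/
theorem lintegral_eq_top_of_rpow_le {d : ℕ} (hd : 1 ≤ d) {s C : ℝ} (hs : 0 < s) (hC : 0 < C)
    {K : Vd d → ℝ≥0∞}
    (hK : ∀ x : Vd d, x ≠ 0 → ENNReal.ofReal (C * ‖x‖ ^ (-(d : ℝ) - s)) ≤ K x) :
    ∫⁻ x, K x = ⊤ := by
  have : Nonempty (Fin d) := ⟨⟨0, hd⟩⟩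
  have : Nontrivial (Vd d) := inferInstance
  set V := volume (Metric.ball (0 : Vd d) 1)
  have hV : V ≠ 0 := (Metric.measure_ball_pos _ _ one_pos).ne'
  have key : ∀ t : ℝ, 0 < t → ENNReal.ofReal (C * t) * V ≤ ∫⁻ x, K x := by
    intro t ht
    set r := t ^ (-s⁻¹) with hr
    have hr0 : 0 < r := Real.rpow_pos_of_pos ht _
    have hrs : r ^ (-(d : ℝ) - s) * r ^ d = t := by
      rw [← Real.rpow_natCast, ← Real.rpow_add hr0, hr, ← Real.rpow_mul ht.le]
      have : -s⁻¹ * (-(d : ℝ) - s + d) = 1 := by field_simp; ring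
      rw [this, Real.rpow_one]
    have hball : volume (Metric.ball (0 : Vd d) r) = ENNReal.ofReal (r ^ d) * V := by
      rw [Measure.addHaar_ball _ _ hr0.le]; simp [V]
    calc ENNReal.ofReal (C * t) * V
        = ∫⁻ _ in Metric.ball (0 : Vd d) r, ENNReal.ofReal (C * r ^ (-(d : ℝ) - s)) := by
          rw [setLIntegral_const, hball, ← mul_assoc, ← ENNReal.ofReal_mul (by positivity),
            mul_assoc, hrs]
      _ ≤ ∫⁻ x in Metric.ball (0 : Vd d) r, K x := by
          have h0 : ∀ᵐ x : Vd d ∂volume.restrict (Metric.ball 0 r), x ≠ 0 :=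
            ae_restrict_of_ae (by simp [ae_iff])
          refine lintegral_mono_ae ?_
          filter_upwards [h0, ae_restrict_mem measurableSet_ball] with x hx hxr
          refine le_trans (ENNReal.ofReal_le_ofReal ?_) (hK x hx)
          refine mul_le_mul_of_nonneg_left ?_ hC.le
          refine Real.rpow_le_rpow_of_nonpos (norm_pos_iff.2 hx) ?_ ?_
          · simpa using (Metric.mem_ball.1 hxr).le
          · have : (0 : ℝ) ≤ d := by positivity
            linarith
      _ ≤ ∫⁻ x, K x := setLIntegral_le_lintegral _ _
  by_contra hne
  have ha : ENNReal.ofReal C * V ≠ 0 := mul_ne_zero (by simpa using hC) hV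
  obtain ⟨n, hn⟩ := ENNReal.exists_nat_mul_gt ha hne
  have hn0 : (0 : ℝ) < n := by
    rcases Nat.eq_zero_or_pos n with rfl | h
    · simp at hn
    · exact_mod_cast h
  refine absurd (key n hn0) (not_le.2 (hn.trans_eq ?_))
  rw [ENNReal.ofReal_mul hC.le, ENNReal.ofReal_natCast]
  ring

/-- The relaxation of the nonlocal perimeter of an integrable kernel to densities on `ν`. -/
def relaxedPer {d : ℕ} (k : Vd d → ℝ) (ν : Measure (Vd d)) (f : Vd d → ℝ) : ℝ :=
  (∫ x, k x) * (∫ x, f x ∂ν) - ∫ x, (∫ y, k (x - y) * f y ∂ν) * f x ∂ν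

theorem relaxedPer_congr {d : ℕ} {k : Vd d → ℝ} {ν : Measure (Vd d)} {f g : Vd d → ℝ}
    (h : f =ᵐ[ν] g) : relaxedPer k ν f = relaxedPer k ν g := by
  have h1 : ∀ x, ∫ y, k (x - y) * f y ∂ν = ∫ y, k (x - y) * g y ∂ν := fun x =>
    integral_congr_ae (h.mono fun y hy => by simp only [hy])
  rw [relaxedPer, relaxedPer, integral_congr_ae h]
  congr 1
  refine integral_congr_ae (h.mono fun x hx => ?_)
  simp only [h1, hx]

/-- On indicators, the relaxed perimeter is the nonlocal perimeter. -/
theorem ofReal_relaxedPer_indicator {d : ℕ} {k : Vd d → ℝ} (hk : Measurable k)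
    (hki : Integrable k) (hk0 : ∀ x, 0 ≤ k x) {D E : Set (Vd d)} (hE : MeasurableSet E)
    (hED : E ⊆ D) (hD : volume D ≠ ⊤) :
    ENNReal.ofReal (relaxedPer k (volume.restrict D) (E.indicator 1)) =
      ∫⁻ x in E, ∫⁻ y in Eᶜ, ENNReal.ofReal (k (x - y)) := by
  have hEfin : volume E ≠ ⊤ := ne_top_of_le_ne_top hD (measure_mono hED)
  have : IsFiniteMeasure (volume.restrict E) := ⟨by simpa using hEfin.lt_top⟩
  have e : ∀ w : Vd d → ℝ, ∫ x in D, w x * E.indicator 1 x = ∫ x in E, w x := fun w => by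
    have : (fun x => w x * E.indicator (1 : Vd d → ℝ) x) = E.indicator w := by
      ext x; by_cases h : x ∈ E <;> simp [h]
    rw [this, setIntegral_indicator hE, Set.inter_eq_right.2 hED]
  have e0 : ∫ x in D, E.indicator (1 : Vd d → ℝ) x = ∫ x in E, (1 : ℝ) := by
    simpa using e fun _ => 1
  have hkx : ∀ x, Integrable fun y => k (x - y) := fun x => hki.comp_sub_left x
  have hkap : ∀ x, ∫ y, k (x - y) = ∫ y, k y := fun x => integral_sub_left_eq_self k volume x
  have hmeas : ∀ A : Set (Vd d), Measurable fun x => ∫ y in A, k (x - y) := fun A =>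
    (hk.comp (measurable_fst.sub measurable_snd)).stronglyMeasurable.integral_prod_right'.measurable
  have hle : ∀ (A : Set (Vd d)) x, ∫ y in A, k (x - y) ≤ ∫ y, k y := fun A x => by
    rw [← hkap x]
    exact setIntegral_le_integral (hkx x) (Eventually.of_forall fun y => hk0 _)
  have hnn : ∀ (A : Set (Vd d)) x, 0 ≤ ∫ y in A, k (x - y) := fun A x =>
    integral_nonneg fun y => hk0 _
  have hint : ∀ A : Set (Vd d), Integrable (fun x => ∫ y in A, k (x - y)) (volume.restrict E) :=
    fun A => Integrable.of_bound (hmeas A).aestronglyMeasurable (∫ y, k y)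
      (Eventually.of_forall fun x => by
        rw [Real.norm_eq_abs, abs_of_nonneg (hnn A x)]; exact hle A x)
  have main : relaxedPer k (volume.restrict D) (E.indicator 1) =
      ∫ x in E, ∫ y in Eᶜ, k (x - y) := by
    rw [relaxedPer, e0, ← integral_const_mul]
    simp only [e, mul_one]
    rw [← integral_sub (integrable_const _) (hint E)]
    refine integral_congr_ae (Eventually.of_forall fun x => ?_)
    have := integral_add_compl hE (hkx x)
    simp only
    rw [← hkap x, ← this]; ring
  rw [main, ofReal_integral_eq_lintegral_ofReal (hint _) (Eventually.of_forall (hnn _))]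
  refine lintegral_congr fun x => ?_
  exact ofReal_integral_eq_lintegral_ofReal (hkx x).integrableOn
    (Eventually.of_forall fun y => hk0 _)

/-- A weak limit whose relaxed perimeters stay bounded along kernels of diverging mass is, almost
everywhere, an indicator. -/
theorem ae_eq_zero_or_one_of_relaxedPer_le {d : ℕ} {K : Vd d → ℝ≥0∞} (hK : Measurable K)
    (hsymm : ∀ x, K (-x) = K x) (htop : ∫⁻ x, K x = ⊤) {D : Set (Vd d)} (hD : volume D ≠ ⊤)
    {f : Vd d → ℝ} (hf : Measurable f) (hf01 : ∀ x, f x ∈ Set.Icc (0 : ℝ) 1) {M : ℝ≥0∞}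
    (hM : M ≠ ⊤)
    (h : ∀ j, ENNReal.ofReal (relaxedPer (truncKernel K j) (volume.restrict D) f) ≤ M) :
    ∀ᵐ x ∂volume.restrict D, f x = 0 ∨ f x = 1 := by
  have : IsFiniteMeasure (volume.restrict D) := ⟨by simpa using hD.lt_top⟩
  have hfi : Integrable f (volume.restrict D) := integrable_of_bdd hf (B := 1) fun x => by
    rw [abs_of_nonneg (hf01 x).1]; exact (hf01 x).2
  have hsq : Integrable (fun x => f x ^ 2) (volume.restrict D) :=
    integrable_of_bdd (hf.pow_const 2) (B := 1) fun x => by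
      rw [abs_of_nonneg (sq_nonneg _)]; exact pow_le_one₀ (hf01 x).1 (hf01 x).2
  have hnn : ∀ x, 0 ≤ f x - f x ^ 2 := fun x => by nlinarith [(hf01 x).1, (hf01 x).2]
  set c := ∫ x in D, (f x - f x ^ 2) with hc
  have hbound : ∀ j, (∫ x, truncKernel K j x) * c ≤ M.toReal := by
    intro j
    have h1 : relaxedPer (truncKernel K j) (volume.restrict D) f ≤ M.toReal :=
      (ENNReal.ofReal_le_iff_le_toReal hM).1 (h j)
    have h2 := integral_quadratic_le (ν := volume.restrict D) hf hf01
      (k := fun x y => truncKernel K j (x - y))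
      ((measurable_truncKernel hK j).comp (measurable_fst.sub measurable_snd))
      (fun x y => truncKernel_mem_Icc j _)
      (fun x y => by rw [← truncKernel_neg hsymm, neg_sub]) (κ := ∫ x, truncKernel K j x)
      (fun x => by
        rw [← integral_sub_left_eq_self (truncKernel K j) volume x]
        exact setIntegral_le_integral ((integrable_truncKernel hK j).comp_sub_left x)
          (Eventually.of_forall fun y => (truncKernel_mem_Icc j _).1))
    rw [hc, integral_sub hfi hsq]
    rw [relaxedPer] at h1
    linarith
  have hc0 : c = 0 := by
    by_contra hne
    have hcpos : 0 < c := lt_of_le_of_ne (integral_nonneg hnn) (Ne.symm hne)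
    have hle : ∀ j, ∫⁻ x, ENNReal.ofReal (truncKernel K j x) ≤ ENNReal.ofReal (M.toReal / c) := by
      intro j
      rw [← ofReal_integral_eq_lintegral_ofReal (integrable_truncKernel hK j)
        (Eventually.of_forall fun x => (truncKernel_mem_Icc j x).1)]
      exact ENNReal.ofReal_le_ofReal ((le_div_iff₀ hcpos).2 (hbound j))
    have := le_of_tendsto' (tendsto_lintegral_truncKernel hK) hle
    rw [htop] at this
    exact ENNReal.ofReal_ne_top (top_le_iff.1 this)
  have := (integral_eq_zero_iff_of_nonneg hnn (hfi.sub hsq)).1 hc0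
  filter_upwards [this] with x hx
  have hx' : f x * (1 - f x) = 0 := by
    have : f x - f x ^ 2 = 0 := hx
    linarith
  rcases mul_eq_zero.1 hx' with h0 | h1
  · exact Or.inl h0
  · exact Or.inr (by linarith)

theorem AdmissiblePart.volume_ne_top {d : ℕ} {D : Set (Vd d)} {N : ℕ} {v : Fin N → ℝ}
    {E : Fin N → Set (Vd d)} (hE : AdmissiblePart D v E) : volume D ≠ ⊤ := by
  obtain ⟨-, -, hvol, -, hcov⟩ := hE
  have h : volume D ≤ volume (D \ ⋃ i, E i) + ∑ i, volume (E i) := by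
    calc volume D ≤ volume ((D \ ⋃ i, E i) ∪ ⋃ i, E i) :=
          measure_mono fun x hx => by by_cases h : x ∈ ⋃ i, E i <;> simp_all
      _ ≤ _ := (measure_union_le _ _).trans (add_le_add le_rfl (measure_iUnion_fintype_le _ _))
  refine ne_top_of_le_ne_top ?_ h
  rw [hcov, zero_add]
  exact ENNReal.sum_ne_top.2 fun i _ => by rw [hvol]; exact ENNReal.ofReal_ne_top

/-- The indicators of an admissible partition sum to one. -/
theorem AdmissiblePart.ae_sum_indicator_eq_one {d : ℕ} {D : Set (Vd d)} {N : ℕ} {v : Fin N → ℝ}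
    {E : Fin N → Set (Vd d)} (hE : AdmissiblePart D v E) (hD : MeasurableSet D) :
    ∀ᵐ x ∂volume.restrict D, ∑ i, (E i).indicator (1 : Vd d → ℝ) x = 1 := by
  obtain ⟨-, -, -, hdisj, hcov⟩ := hE
  have h1 : ∀ᵐ x, ∀ i j, i ≠ j → x ∉ E i ∩ E j := by
    simp only [ae_all_iff]
    exact fun i j hij => measure_eq_zero_iff_ae_notMem.1 (hdisj i j hij)
  have h2 : ∀ᵐ x, x ∉ D \ ⋃ i, E i := measure_eq_zero_iff_ae_notMem.1 hcov
  filter_upwards [ae_restrict_of_ae h1, ae_restrict_of_ae h2, ae_restrict_mem hD]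
    with x hx1 hx2 hxD
  obtain ⟨i, hi⟩ : ∃ i, x ∈ E i := by
    by_contra hne
    exact hx2 ⟨hxD, by simpa using hne⟩
  rw [Finset.sum_eq_single i]
  · simp [hi]
  · intro j _ hj
    exact Set.indicator_of_notMem (fun hxj => hx1 i j (Ne.symm hj) ⟨hi, hxj⟩) _
  · simp

/-- Indicator-valued weak limits of admissible partitions define an admissible partition. -/
theorem admissiblePart_of_tendstoWeakly {d : ℕ} {D : Set (Vd d)} (hDm : MeasurableSet D)
    (hD : volume D ≠ ⊤) {N : ℕ} {v : Fin N → ℝ} (hv : ∀ i, 0 ≤ v i)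
    {E : ℕ → Fin N → Set (Vd d)}
    (hE : ∀ n, AdmissiblePart D v (E n)) {f : Fin N → Vd d → ℝ} (hf : ∀ i, Measurable (f i))
    (hf01 : ∀ i, ∀ᵐ x ∂volume.restrict D, f i x = 0 ∨ f i x = 1)
    (hf01' : ∀ i x, f i x ∈ Set.Icc (0 : ℝ) 1)
    (hw : ∀ i, TendstoWeakly (volume.restrict D) (fun n => (E n i).indicator 1) (f i)) :
    AdmissiblePart D v (fun i => D ∩ f i ⁻¹' {1}) := by
  have : IsFiniteMeasure (volume.restrict D) := ⟨by simpa using hD.lt_top⟩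
  have hm : ∀ i, MeasurableSet (f i ⁻¹' {1}) := fun i => hf i (measurableSet_singleton 1)
  have hi : ∀ i, Integrable (f i) (volume.restrict D) := fun i =>
    integrable_of_bdd (hf i) (B := 1) fun x => by
      rw [abs_of_nonneg (hf01' i x).1]; exact (hf01' i x).2
  have hiE : ∀ n i, Integrable ((E n i).indicator (1 : Vd d → ℝ)) (volume.restrict D) :=
    fun n i => (integrable_const (1 : ℝ)).indicator ((hE n).1 i)
  have hset : ∀ i, ∀ s : Set (Vd d), MeasurableSet s →
      Tendsto (fun n => ∫ x in s, (E n i).indicator (1 : Vd d → ℝ) x ∂volume.restrict D) atTop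
        (𝓝 (∫ x in s, f i x ∂volume.restrict D)) := by
    intro i s hs
    have := hw i (s.indicator 1) (measurable_one.indicator hs) ⟨1, fun x => by
      by_cases h : x ∈ s <;> simp [h]⟩
    have e : ∀ w : Vd d → ℝ, ∫ x, s.indicator 1 x * w x ∂volume.restrict D =
        ∫ x in s, w x ∂volume.restrict D := fun w => by
      rw [← integral_indicator hs]
      congr 1; ext x; by_cases h : x ∈ s <;> simp [h]
    simpa only [e] using this
  have hsum : ∀ᵐ x ∂volume.restrict D, ∑ i, f i x = 1 := by
    refine ae_eq_of_forall_setIntegral_eq_of_sigmaFinite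
      (fun s _ _ => (integrable_finsetSum _ fun i _ => hi i).integrableOn)
      (fun s _ _ => (integrable_const (1 : ℝ)).integrableOn) fun s hs _ => ?_
    have h1 := tendsto_finsetSum Finset.univ fun i _ => hset i s hs
    rw [← integral_finsetSum _ fun i _ => (hi i).integrableOn] at h1
    refine tendsto_nhds_unique h1 (tendsto_const_nhds.congr fun n => ?_)
    rw [← integral_finsetSum _ fun i _ => (hiE n i).integrableOn]
    refine integral_congr_ae (ae_restrict_of_ae ?_)
    filter_upwards [(hE n).ae_sum_indicator_eq_one hDm] with x hx using hx.symm
  have hind : ∀ i, f i =ᵐ[volume.restrict D] (f i ⁻¹' {1}).indicator 1 := fun i => by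
    filter_upwards [hf01 i] with x hx
    rcases hx with hx | hx <;> simp [Set.indicator, hx]
  refine ⟨fun i => hDm.inter (hm i), fun i => Set.inter_subset_left, fun i => ?_,
    fun i j hij => ?_, ?_⟩
  · have h1 := hset i Set.univ MeasurableSet.univ
    simp only [Measure.restrict_univ] at h1
    have h2 : ∀ n, ∫ x in D, (E n i).indicator (1 : Vd d → ℝ) x = v i := fun n => by
      rw [integral_indicator_one ((hE n).1 i), measureReal_restrict_apply ((hE n).1 i),
        Set.inter_eq_left.2 ((hE n).2.1 i), measureReal_def, (hE n).2.2.1 i,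
        ENNReal.toReal_ofReal (hv i)]
    simp only [h2] at h1
    have h3 := tendsto_nhds_unique h1 tendsto_const_nhds
    rw [integral_congr_ae (hind i), integral_indicator_one (hm i),
      measureReal_restrict_apply (hm i), Set.inter_comm] at h3
    rw [← h3, measureReal_def, ENNReal.ofReal_toReal]
    exact ne_top_of_le_ne_top hD (measure_mono Set.inter_subset_left)
  · rw [measure_eq_zero_iff_ae_notMem]
    filter_upwards [(ae_restrict_iff' hDm).1 hsum] with x hx
    rintro ⟨⟨hxD, hxi⟩, -, hxj⟩
    have hs := hx hxD
    have : f i x + f j x ≤ ∑ l, f l x := by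
      rw [← Finset.sum_pair (f := fun l => f l x) hij]
      exact Finset.sum_le_sum_of_subset_of_nonneg (Finset.subset_univ _)
        fun l _ _ => (hf01' l x).1
    rw [hxi, hxj, hs] at this
    norm_num at this
  · rw [measure_eq_zero_iff_ae_notMem]
    filter_upwards [(ae_restrict_iff' hDm).1 hsum,
      (ae_restrict_iff' hDm).1 (ae_all_iff.2 hf01)] with x hx hx01
    rintro ⟨hxD, hxn⟩
    have h0 : ∀ i, f i x = 0 := fun i => (hx01 hxD i).resolve_right fun h1 =>
      hxn (Set.mem_iUnion.2 ⟨i, hxD, h1⟩)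
    have hs := hx hxD
    simp [h0] at hs

theorem stmt0 {d : ℕ} (hd : 1 ≤ d) (s C : ℝ) (hs : s ∈ Set.Ioo (0:ℝ) 1) (hC : 0 < C)
    (K : Vd d → ℝ≥0∞) (hK : IsKernel s C K)
    (L μ : ℝ) (hL : 0 < L) (hμ : 0 ≤ μ)
    (G : Set (Vd d)) (hG : IsLatticeWithVol G (L ^ d))
    (D : Set (Vd d)) (hD : IsFundDom G D)
    (N : ℕ) (v : Fin N → ℝ) (hv : ∀ i, 0 < v i) (hsum : ∑ i, v i = L ^ d)
    (hfin : sInf {c : ℝ≥0∞ | ∃ E : Fin N → Set (Vd d), AdmissiblePart D v E ∧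
        c = ENNReal.ofReal μ * nlPer K D + 2⁻¹ * ∑ i, nlPer K (E i)} ≠ ⊤) :
    ∃ E : Fin N → Set (Vd d), AdmissiblePart D v E ∧
      ENNReal.ofReal μ * nlPer K D + 2⁻¹ * ∑ i, nlPer K (E i) =
        sInf {c : ℝ≥0∞ | ∃ E' : Fin N → Set (Vd d), AdmissiblePart D v E' ∧
          c = ENNReal.ofReal μ * nlPer K D + 2⁻¹ * ∑ i, nlPer K (E' i)} := by
  obtain ⟨⟨hKm, hKsymm, -⟩, hKlow⟩ := hK
  have htop := lintegral_eq_top_of_rpow_le hd hs.1 hC hKlow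
  set S := {c : ℝ≥0∞ | ∃ E : Fin N → Set (Vd d), AdmissiblePart D v E ∧
    c = ENNReal.ofReal μ * nlPer K D + 2⁻¹ * ∑ i, nlPer K (E i)} with hS
  have hne : S.Nonempty := by
    rw [Set.nonempty_iff_ne_empty]
    intro h
    rw [h, sInf_empty] at hfin
    exact hfin rfl
  obtain ⟨c₀, -, hc₀, hc₀S⟩ := exists_seq_tendsto_sInf hne (OrderBot.bddBelow S)
  choose E₀ hE₀ hcE₀ using hc₀S
  have hDm : MeasurableSet D := hD.1
  have hDfin : volume D ≠ ⊤ := (hE₀ 0).volume_ne_top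
  have : IsFiniteMeasure (volume.restrict D) := ⟨by simpa using hDfin.lt_top⟩
  have hind01 : ∀ (A : Set (Vd d)) x, A.indicator (1 : Vd d → ℝ) x ∈ Set.Icc (0 : ℝ) 1 :=
    fun A x => by by_cases h : x ∈ A <;> simp [h]
  obtain ⟨φ, hφ, f, hf, hf01, hw⟩ := exists_subseq_forall_tendstoWeakly (volume.restrict D)
    (fun (i : Fin N) n => (E₀ n i).indicator (1 : Vd d → ℝ))
    (fun i n => measurable_one.indicator ((hE₀ n).1 i)) (fun i n => hind01 _)
  have hE : ∀ n, AdmissiblePart D v (E₀ (φ n)) := fun n => hE₀ (φ n)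
  have hc := hc₀.comp hφ.tendsto_atTop
  have hlim : ∀ j i, Tendsto
      (fun n => relaxedPer (truncKernel K j) (volume.restrict D) ((E₀ (φ n) i).indicator 1))
      atTop (𝓝 (relaxedPer (truncKernel K j) (volume.restrict D) (f i))) := by
    intro j i
    have h1 := hw i (fun _ => 1) measurable_const ⟨1, by simp⟩
    simp only [one_mul] at h1
    exact (h1.const_mul _).sub ((hw i).tendsto_quadratic
      (fun n => measurable_one.indicator ((hE n).1 i)) (fun n => hind01 _) (hf i) (hf01 i)
      (k := fun x y => truncKernel K j (x - y))
      ((measurable_truncKernel hKm j).comp (measurable_fst.sub measurable_snd)) (B := j)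
      fun x y => by
        rw [abs_of_nonneg (truncKernel_mem_Icc j _).1]; exact (truncKernel_mem_Icc j _).2)
  have hlsc : ∀ j, ENNReal.ofReal μ * nlPer K D + 2⁻¹ * ∑ i, ENNReal.ofReal
      (relaxedPer (truncKernel K j) (volume.restrict D) (f i)) ≤ sInf S := by
    intro j
    refine le_of_tendsto_of_tendsto' (tendsto_const_nhds.add (ENNReal.Tendsto.const_mul
      (tendsto_finsetSum _ fun i _ => ENNReal.tendsto_ofReal (hlim j i))
      (Or.inr (by norm_num)))) hc fun n => ?_
    simp only [Function.comp_apply, hcE₀]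
    gcongr with i
    rw [ofReal_relaxedPer_indicator (measurable_truncKernel hKm j) (integrable_truncKernel hKm j)
      (fun x => (truncKernel_mem_Icc j x).1) ((hE n).1 i) ((hE n).2.1 i) hDfin]
    exact lintegral_mono fun x => lintegral_mono fun y =>
      (monotone_ofReal_truncKernel (x - y)).ge_of_tendsto (tendsto_ofReal_truncKernel (x - y)) j
  have hbd : ∀ i j, ENNReal.ofReal (relaxedPer (truncKernel K j) (volume.restrict D) (f i)) ≤
      2 * sInf S := by
    intro i j
    calc ENNReal.ofReal (relaxedPer (truncKernel K j) (volume.restrict D) (f i))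
        ≤ ∑ i, ENNReal.ofReal (relaxedPer (truncKernel K j) (volume.restrict D) (f i)) :=
          Finset.single_le_sum (f := fun i => ENNReal.ofReal
            (relaxedPer (truncKernel K j) (volume.restrict D) (f i))) (fun _ _ => zero_le)
            (Finset.mem_univ i)
      _ = 2 * (2⁻¹ * ∑ i, ENNReal.ofReal
            (relaxedPer (truncKernel K j) (volume.restrict D) (f i))) := by
          rw [← mul_assoc, ENNReal.mul_inv_cancel (by norm_num) (by norm_num), one_mul]
      _ ≤ 2 * sInf S := by gcongr; exact le_add_self.trans (hlsc j)
  have hf01ae : ∀ i, ∀ᵐ x ∂volume.restrict D, f i x = 0 ∨ f i x = 1 := fun i =>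
    ae_eq_zero_or_one_of_relaxedPer_le hKm hKsymm htop hDfin (hf i) (hf01 i)
      (ENNReal.mul_ne_top (by norm_num) hfin) (hbd i)
  have hF := admissiblePart_of_tendstoWeakly hDm hDfin (fun i => (hv i).le) hE hf hf01ae hf01 hw
  refine ⟨fun i => D ∩ f i ⁻¹' {1}, hF, le_antisymm ?_ (sInf_le ⟨_, hF, rfl⟩)⟩
  have hfF : ∀ i, f i =ᵐ[volume.restrict D] (D ∩ f i ⁻¹' {1}).indicator 1 := fun i => by
    filter_upwards [hf01ae i, ae_restrict_mem hDm] with x hx hxD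
    rcases hx with hx | hx <;> simp [Set.indicator, hx, hxD]
  refine le_of_tendsto' (tendsto_const_nhds.add (ENNReal.Tendsto.const_mul
    (tendsto_finsetSum _ fun i _ => tendsto_nlPer_truncKernel hKm _ _)
    (Or.inr (by norm_num)))) fun j => ?_
  refine le_of_eq_of_le ?_ (hlsc j)
  congr 2
  refine Finset.sum_congr rfl fun i _ => ?_
  rw [relaxedPer_congr (hfF i), ofReal_relaxedPer_indicator (measurable_truncKernel hKm j)
    (integrable_truncKernel hKm j) (fun x => (truncKernel_mem_Icc j x).1) (hF.1 i) (hF.2.1 i) hDfin]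

end
end

section
/- Let d ≥ 1, L > 0, μ ≥ 0, let G be a lattice in ℝ^d with d(G) = L^d, and let 𝑣 = (v_1,…,v_N) be a volume vector with ∑_i v_i = L^d. Define F_μ(G,𝑣) := inf_D inf{ μ·Per_K(D) + (1/2)·∑_{i=1}^N Per_K(E_i) : E_i ⊆ D Borel, |E_i| = v_i, |E_i ∩ E_j| = 0 for i ≠ j, |D ∖ ⋃_i E_i| = 0 }, where the outer infimum runs over all fundamental domains D for G and Per_K is the nonlocal perimeter. Then F_μ(G,𝑣) is finite and there exist a fundamental domain D for G and a partition (E_1,…,E_N) of D attaining F_μ(G,𝑣). -/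
open MeasureTheory Filter Topology
open scoped symmDiff ENNReal

noncomputable section

variable {d : ℕ}

/-! ### The interaction measure of the kernel -/

/-- The measure `K (x - y) dx dy` on pairs of points. -/
def pairMeasure (K : Vd d → ℝ≥0∞) : Measure (Vd d × Vd d) :=
  (volume.prod volume).withDensity fun p => K (p.1 - p.2)

lemma pairMeasure_prod {K : Vd d → ℝ≥0∞} (hK : Measurable K) {A B : Set (Vd d)}
    (hA : MeasurableSet A) (hB : MeasurableSet B) :
    pairMeasure K (A ×ˢ B) = ∫⁻ x in A, ∫⁻ y in B, K (x - y) := by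
  have hm : Measurable fun p : Vd d × Vd d => K (p.1 - p.2) := by fun_prop
  rw [pairMeasure, withDensity_apply _ (hA.prod hB), ← Measure.prod_restrict,
    lintegral_prod _ hm.aemeasurable]

lemma nlPer_eq_pairMeasure {K : Vd d → ℝ≥0∞} (hK : Measurable K) {E : Set (Vd d)}
    (hE : MeasurableSet E) : nlPer K E = pairMeasure K (E ×ˢ Eᶜ) :=
  (pairMeasure_prod hK hE hE.compl).symm

lemma nlPer_congr_ae (K : Vd d → ℝ≥0∞) {E F : Set (Vd d)} (h : E =ᵐ[volume] F) :
    nlPer K E = nlPer K F := by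
  unfold nlPer
  rw [setLIntegral_congr h]
  congr 1
  ext x
  exact setLIntegral_congr h.compl

lemma nlPer_iUnion_le {K : Vd d → ℝ≥0∞} (hK : Measurable K) {ι : Type*} [Countable ι]
    {F : ι → Set (Vd d)} (hF : ∀ i, MeasurableSet (F i)) :
    nlPer K (⋃ i, F i) ≤ ∑' i, nlPer K (F i) := by
  rw [nlPer_eq_pairMeasure hK (.iUnion hF)]
  simp_rw [fun i => nlPer_eq_pairMeasure hK (hF i)]
  refine le_trans (measure_mono ?_) (measure_iUnion_le _)
  rintro ⟨x, y⟩ ⟨hx, hy⟩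
  simp only [Set.mem_iUnion, Set.mem_compl_iff, not_exists] at hx hy ⊢
  obtain ⟨i, hi⟩ := hx
  exact ⟨i, hi, hy i⟩

lemma measurePreserving_add_pair (g : Vd d) :
    MeasurePreserving (fun p : Vd d × Vd d => (p.1 + g, p.2 + g))
      (volume.prod volume) (volume.prod volume) :=
  (measurePreserving_add_right volume g).prod (measurePreserving_add_right volume g)

lemma pairMeasure_preimage_add {K : Vd d → ℝ≥0∞} (hK : Measurable K) (g : Vd d)
    {S : Set (Vd d × Vd d)} (hS : MeasurableSet S) :
    pairMeasure K ((fun p : Vd d × Vd d => (p.1 + g, p.2 + g)) ⁻¹' S) = pairMeasure K S := by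
  have hm : Measurable fun p : Vd d × Vd d => K (p.1 - p.2) := by fun_prop
  have hmp := measurePreserving_add_pair g
  rw [pairMeasure, withDensity_apply _ hS, withDensity_apply _ (hmp.measurable hS),
    ← hmp.setLIntegral_comp_preimage hS hm]
  simp

lemma nlPer_preimage_add {K : Vd d → ℝ≥0∞} (hK : Measurable K) (g : Vd d)
    {E : Set (Vd d)} (hE : MeasurableSet E) :
    nlPer K ((fun x => x + g) ⁻¹' E) = nlPer K E := by
  rw [nlPer_eq_pairMeasure hK hE, nlPer_eq_pairMeasure hK (measurable_add_const g hE),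
    ← pairMeasure_preimage_add hK g (hE.prod hE.compl)]
  rfl

lemma pairMeasure_ae_fst {K : Vd d → ℝ≥0∞} {p : Vd d → Prop} (h : ∀ᵐ x, p x) :
    ∀ᵐ z ∂pairMeasure K, p z.1 :=
  (withDensity_absolutelyContinuous _ _).ae_le (Measure.quasiMeasurePreserving_fst.ae h)

lemma pairMeasure_ae_snd {K : Vd d → ℝ≥0∞} {p : Vd d → Prop} (h : ∀ᵐ x, p x) :
    ∀ᵐ z ∂pairMeasure K, p z.2 :=
  (withDensity_absolutelyContinuous _ _).ae_le (Measure.quasiMeasurePreserving_snd.ae h)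

/-- Lower semicontinuity: if translates of `F n` along centres that drift apart converge almost
everywhere to sets `H i`, the total perimeter of the `H i` is at most the limit perimeter. -/
theorem tsum_nlPer_le_of_tendsto {K : Vd d → ℝ≥0∞} (hK : Measurable K) {ι : Type*}
    {F : ℕ → Set (Vd d)} (hF : ∀ n, MeasurableSet (F n)) {g : ℕ → ι → Vd d}
    {H : ι → Set (Vd d)} (hH : ∀ i, MeasurableSet (H i))
    (hg : ∀ i j, i ≠ j → Tendsto (fun n => ‖g n i - g n j‖) atTop atTop)
    (hlim : ∀ i, ∀ᵐ x, ∀ᶠ n in atTop, (x + g n i ∈ F n ↔ x ∈ H i))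
    {a : ℝ≥0∞} (ha : Tendsto (fun n => nlPer K (F n)) atTop (𝓝 a)) :
    ∑' i, nlPer K (H i) ≤ a := by
  classical
  rw [ENNReal.tsum_eq_iSup_sum]
  refine iSup_le fun T => ?_
  let W : ℕ → ι → Set (Vd d) := fun n i =>
    {x | ∀ j ∈ T, j ≠ i → ‖x - g n i‖ < ‖x - g n j‖}
  have hW : ∀ n i, MeasurableSet (W n i) := by
    intro n i
    have : W n i = ⋂ j ∈ T, ⋂ (_ : j ≠ i), {x | ‖x - g n i‖ < ‖x - g n j‖} := by
      ext x; simp [W]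
    rw [this]
    refine Finset.measurableSet_biInter _ fun j _ => MeasurableSet.iInter fun _ => ?_
    exact measurableSet_lt (by fun_prop) (by fun_prop)
  let S : ℕ → ι → Set (Vd d × Vd d) := fun n i => (F n ∩ W n i) ×ˢ (W n i \ F n)
  have hS : ∀ n i, MeasurableSet (S n i) := fun n i =>
    ((hF n).inter (hW n i)).prod ((hW n i).diff (hF n))
  let A : ℕ → ι → Set (Vd d × Vd d) := fun n i =>
    (fun p : Vd d × Vd d => (p.1 + g n i, p.2 + g n i)) ⁻¹' S n i
  let B : ι → ℕ → Set (Vd d × Vd d) := fun i m => ⋂ n ≥ m, A n i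
  have hBmono : ∀ i, Monotone (B i) := by
    intro i m m' hmm
    exact Set.biInter_mono (fun n hn => le_trans hmm hn) fun _ _ => le_rfl
  have hsum : ∀ m, ∑ i ∈ T, pairMeasure K (B i m) ≤ nlPer K (F m) := by
    intro m
    calc ∑ i ∈ T, pairMeasure K (B i m) ≤ ∑ i ∈ T, pairMeasure K (S m i) := by
          refine Finset.sum_le_sum fun i _ => ?_
          rw [← pairMeasure_preimage_add hK (g m i) (hS m i)]
          exact measure_mono (Set.biInter_subset_of_mem (show m ≥ m from le_rfl))
      _ = pairMeasure K (⋃ i ∈ T, S m i) := by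
          refine (measure_biUnion_finset ?_ fun i _ => hS m i).symm
          intro i hi j hj hij
          refine Set.disjoint_left.2 ?_
          rintro ⟨x, y⟩ ⟨hx, -⟩ ⟨hx', -⟩
          exact lt_asymm (hx.2 j hj hij.symm) (hx'.2 i hi hij)
      _ ≤ pairMeasure K (F m ×ˢ (F m)ᶜ) := by
          refine measure_mono (Set.iUnion₂_subset fun i _ => ?_)
          rintro ⟨x, y⟩ ⟨hx, hy⟩
          exact ⟨hx.1, hy.2⟩
      _ = _ := (nlPer_eq_pairMeasure hK (hF m)).symm
  have htend : Tendsto (fun m => ∑ i ∈ T, pairMeasure K (B i m)) atTop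
      (𝓝 (∑ i ∈ T, pairMeasure K (⋃ m, B i m))) :=
    tendsto_finsetSum _ fun i _ => tendsto_measure_iUnion_atTop (hBmono i)
  refine le_trans (Finset.sum_le_sum fun i hi => ?_) (le_of_tendsto_of_tendsto' htend ha hsum)
  rw [nlPer_eq_pairMeasure hK (hH i)]
  refine measure_mono_ae ?_
  have hWev : ∀ x : Vd d, ∀ᶠ n in atTop, x + g n i ∈ W n i := by
    intro x
    have : ∀ j ∈ T, ∀ᶠ n in atTop, j ≠ i → ‖x + g n i - g n i‖ < ‖x + g n i - g n j‖ := by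
      intro j _
      by_cases hji : j = i
      · exact .of_forall fun n h => absurd hji h
      · filter_upwards [(hg i j (Ne.symm hji)).eventually_gt_atTop (2 * ‖x‖)] with n hn _
        have : ‖g n i - g n j‖ ≤ ‖x + g n i - g n j‖ + ‖x‖ := by
          have := norm_sub_le (x + g n i - g n j) x
          rwa [show x + g n i - g n j - x = g n i - g n j by abel] at this
        rw [add_sub_cancel_right]
        linarith
    exact (T.eventually_all).2 this
  filter_upwards [pairMeasure_ae_fst (K := K) (hlim i), pairMeasure_ae_snd (K := K) (hlim i)]
    with z h1 h2 hz
  obtain ⟨m, hm⟩ := eventually_atTop.1 (h1.and (h2.and ((hWev z.1).and (hWev z.2))))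
  refine Set.mem_iUnion.2 ⟨m, Set.mem_iInter₂.2 fun n hn => ?_⟩
  obtain ⟨e1, e2, w1, w2⟩ := hm n hn
  exact ⟨⟨e1.2 hz.1, w1⟩, w2, fun h => hz.2 (e2.1 h)⟩

/-! ### Lattice coordinates -/

/-- The lattice vector with given integer coordinates. -/
def latVec (b : Module.Basis (Fin d) ℝ (Vd d)) : (Fin d → ℤ) →+ Vd d where
  toFun k := ∑ i, (k i : ℝ) • b i
  map_zero' := by simp
  map_add' k l := by simp [add_smul, Finset.sum_add_distrib]

lemma repr_latVec (b : Module.Basis (Fin d) ℝ (Vd d)) (k : Fin d → ℤ) (i : Fin d) :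
    b.repr (latVec b k) i = k i := by
  have : latVec b k = ∑ i, (k i : ℝ) • b i := rfl
  rw [this, b.repr_sum_self]

lemma latVec_injective (b : Module.Basis (Fin d) ℝ (Vd d)) : Function.Injective (latVec b) := by
  intro k l h
  ext i
  have := congrArg (fun x => b.repr x i) h
  simpa [repr_latVec] using this

lemma continuous_repr (b : Module.Basis (Fin d) ℝ (Vd d)) (i : Fin d) :
    Continuous fun x : Vd d => b.repr x i :=
  (b.coord i).continuous_of_finiteDimensional

lemma exists_abs_repr_le (b : Module.Basis (Fin d) ℝ (Vd d)) :
    ∃ c : ℝ, 0 ≤ c ∧ ∀ x i, |b.repr x i| ≤ c * ‖x‖ := by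
  let f : Vd d →L[ℝ] (Fin d → ℝ) := LinearMap.toContinuousLinearMap (b.equivFun : Vd d →ₗ[ℝ] _)
  refine ⟨‖f‖, norm_nonneg _, fun x i => ?_⟩
  exact (norm_le_pi_norm (f x) i).trans (f.le_opNorm x)

lemma tendsto_norm_latVec (b : Module.Basis (Fin d) ℝ (Vd d)) :
    Tendsto (fun k => ‖latVec b k‖) cofinite atTop := by
  obtain ⟨c, hc, h⟩ := exists_abs_repr_le b
  refine tendsto_atTop.2 fun R => ?_
  rw [eventually_cofinite]
  refine (Set.finite_Icc (fun _ : Fin d => ⌊-(c * R)⌋) fun _ => ⌈c * R⌉).subset ?_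
  intro k hk
  simp only [Set.mem_ofPred_eq, not_le] at hk
  have hb : ∀ i, |(k i : ℝ)| ≤ c * R := fun i => by
    rw [← repr_latVec b k i]
    exact (h _ i).trans (mul_le_mul_of_nonneg_left hk.le hc)
  refine ⟨fun i => ?_, fun i => ?_⟩
  · have := (abs_le.1 (hb i)).1
    exact_mod_cast (Int.floor_le _).trans this
  · have := (abs_le.1 (hb i)).2
    exact_mod_cast this.trans (Int.le_ceil _)

/-- A half-open box in the coordinates of the basis. -/
def box (b : Module.Basis (Fin d) ℝ (Vd d)) (α β : Fin d → ℝ) : Set (Vd d) :=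
  {x | ∀ i, b.repr x i ∈ Set.Ico (α i) (β i)}

lemma measurableSet_box (b : Module.Basis (Fin d) ℝ (Vd d)) (α β : Fin d → ℝ) :
    MeasurableSet (box b α β) := by
  have : box b α β = ⋂ i, (fun x => b.repr x i) ⁻¹' Set.Ico (α i) (β i) := by
    ext x; simp [box]
  rw [this]
  exact .iInter fun i => (continuous_repr b i).measurable measurableSet_Ico

/-- The volume of the lattice spanned by the basis. -/
def covol (b : Module.Basis (Fin d) ℝ (Vd d)) : ℝ := |Matrix.det (Matrix.of fun i j => b j i)|

lemma covol_pos (b : Module.Basis (Fin d) ℝ (Vd d)) : 0 < covol b := by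
  refine abs_pos.2 ?_
  have h := (EuclideanSpace.basisFun (Fin d) ℝ).toBasis.isUnit_det b
  rw [Module.Basis.det_apply] at h
  convert h.ne_zero using 3
  ext i j
  simp [Module.Basis.toMatrix_apply]

lemma volume_box (b : Module.Basis (Fin d) ℝ (Vd d)) (α β : Fin d → ℝ) :
    volume (box b α β) = ENNReal.ofReal (covol b) * ∏ i, ENNReal.ofReal (β i - α i) := by
  have hpos := covol_pos b
  set A : Matrix (Fin d) (Fin d) ℝ := Matrix.of fun i j => b j i with hA
  have hc : covol b = |A.det| := rfl
  have hdet : A.det ≠ 0 := by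
    rw [hc] at hpos; exact abs_pos.1 hpos
  have hmap := Real.map_matrix_volume_pi_eq_smul_volume_pi hdet
  have hmeas : MeasurableSet ((WithLp.toLp 2 : (Fin d → ℝ) → Vd d) ⁻¹' box b α β) :=
    (PiLp.volume_preserving_toLp (Fin d)).measurable (measurableSet_box b α β)
  have h1 := (PiLp.volume_preserving_toLp (Fin d)).measure_preimage
    (measurableSet_box b α β).nullMeasurableSet
  have h2 : Matrix.toLin' A ⁻¹' ((WithLp.toLp 2 : (Fin d → ℝ) → Vd d) ⁻¹' box b α β) =
      Set.pi Set.univ fun i => Set.Ico (α i) (β i) := by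
    ext y
    have : (WithLp.toLp 2 (Matrix.toLin' A y) : Vd d) = ∑ j, y j • b j := by
      ext i
      simp [hA, Matrix.mulVec, dotProduct, mul_comm]
    simp only [Set.mem_preimage, this, box, Set.mem_ofPred_eq, b.repr_sum_self, Set.mem_univ_pi]
  have h3 := congrArg (fun ν => ν ((WithLp.toLp 2 : (Fin d → ℝ) → Vd d) ⁻¹' box b α β)) hmap
  simp only [Measure.smul_apply, smul_eq_mul] at h3
  rw [Measure.map_apply (by fun_prop) hmeas, h2, h1, Real.volume_pi_Ico] at h3
  rw [h3, ← mul_assoc, hc, ← ENNReal.ofReal_mul (abs_nonneg _), ← abs_mul,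
    mul_inv_cancel₀ hdet]
  simp

/-- The index of the cell of scale `1 / M` containing a point. -/
def cellIdx (b : Module.Basis (Fin d) ℝ (Vd d)) (M : ℕ) (x : Vd d) : Fin d → ℤ :=
  fun i => ⌊(M : ℝ) * b.repr x i⌋

lemma measurable_cellIdx (b : Module.Basis (Fin d) ℝ (Vd d)) (M : ℕ) :
    Measurable (cellIdx b M) := by
  refine measurable_pi_lambda _ fun i => Int.measurable_floor.comp ?_
  exact ((continuous_repr b i).measurable).const_mul _

/-- The cell of scale `1 / M` with a given index. -/
def cell (b : Module.Basis (Fin d) ℝ (Vd d)) (M : ℕ) (k : Fin d → ℤ) : Set (Vd d) :=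
  cellIdx b M ⁻¹' {k}

lemma measurableSet_cell (b : Module.Basis (Fin d) ℝ (Vd d)) (M : ℕ) (k : Fin d → ℤ) :
    MeasurableSet (cell b M k) :=
  measurable_cellIdx b M (measurableSet_singleton k)

lemma cell_eq_box (b : Module.Basis (Fin d) ℝ (Vd d)) {M : ℕ} (hM : 0 < M) (k : Fin d → ℤ) :
    cell b M k = box b (fun i => k i / M) fun i => (k i + 1) / M := by
  have hM' : (0 : ℝ) < M := by exact_mod_cast hM
  ext x
  simp only [cell, cellIdx, Set.mem_preimage, Set.mem_singleton_iff, box, Set.mem_ofPred_eq,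
    funext_iff, Int.floor_eq_iff, Set.mem_Ico, div_le_iff₀ hM', lt_div_iff₀ hM', mul_comm (M : ℝ)]

lemma volume_cell (b : Module.Basis (Fin d) ℝ (Vd d)) {M : ℕ} (hM : 0 < M) (k : Fin d → ℤ) :
    volume (cell b M k) = ENNReal.ofReal (covol b * (1 / M : ℝ) ^ d) := by
  rw [cell_eq_box b hM, volume_box, ENNReal.ofReal_mul (covol_pos b).le,
    ENNReal.ofReal_pow (by positivity)]
  simp [← sub_div]

lemma volume_unit_cell (b : Module.Basis (Fin d) ℝ (Vd d)) (k : Fin d → ℤ) :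
    volume (cell b 1 k) = ENNReal.ofReal (covol b) := by
  simp [volume_cell b one_pos]

lemma measure_eq_tsum_cell (b : Module.Basis (Fin d) ℝ (Vd d)) (M : ℕ) (ν : Measure (Vd d))
    {A : Set (Vd d)} (hA : MeasurableSet A) : ν A = ∑' k, ν (A ∩ cell b M k) := by
  rw [← measure_iUnion]
  · congr 1
    ext x
    simp [cell]
  · intro k l hkl
    refine Set.disjoint_left.2 ?_
    rintro x ⟨-, hx⟩ ⟨-, hx'⟩
    exact hkl (hx.symm.trans hx')
  · exact fun k => hA.inter (measurableSet_cell b M k)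

lemma cellIdx_one_add_latVec (b : Module.Basis (Fin d) ℝ (Vd d)) (x : Vd d) (k : Fin d → ℤ) :
    cellIdx b 1 (x + latVec b k) = cellIdx b 1 x + k := by
  ext i
  simp [cellIdx, repr_latVec]

lemma cellIdx_one_eq (b : Module.Basis (Fin d) ℝ (Vd d)) {M : ℕ} (hM : 0 < M) (x : Vd d)
    (i : Fin d) : cellIdx b 1 x i = cellIdx b M x i / M := by
  have hM' : (M : ℝ) ≠ 0 := by exact_mod_cast hM.ne'
  unfold cellIdx
  rw [← Int.floor_div_natCast, mul_div_cancel_left₀ _ hM']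
  simp

lemma exists_norm_sub_le_of_cell (b : Module.Basis (Fin d) ℝ (Vd d)) :
    ∃ ρ : ℝ, 0 < ρ ∧ ∀ M : ℕ, 0 < M → ∀ x y, cellIdx b M x = cellIdx b M y →
      ‖x - y‖ ≤ ρ / M := by
  refine ⟨∑ i, ‖b i‖ + 1, by positivity, fun M hM x y h => ?_⟩
  have hM' : (0 : ℝ) < M := by exact_mod_cast hM
  have hxy : x - y = ∑ i, b.repr (x - y) i • b i := (b.sum_repr _).symm
  have hi : ∀ i, |b.repr (x - y) i| ≤ 1 / M := by
    intro i
    have h1 := Int.abs_sub_lt_one_of_floor_eq_floor (congrFun h i)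
    rw [← mul_sub, abs_mul, abs_of_pos hM'] at h1
    rw [map_sub, Finsupp.sub_apply, le_div_iff₀ hM', mul_comm]
    exact h1.le
  calc ‖x - y‖ ≤ ∑ i, ‖b.repr (x - y) i • b i‖ := by
        conv_lhs => rw [hxy]
        exact norm_sum_le _ _
    _ ≤ ∑ i, 1 / M * ‖b i‖ := by
        refine Finset.sum_le_sum fun i _ => ?_
        rw [norm_smul]
        exact mul_le_mul_of_nonneg_right (hi i) (norm_nonneg _)
    _ = (∑ i, ‖b i‖) / M := by rw [← Finset.mul_sum]; ring
    _ ≤ _ := by gcongr; linarith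

/-! ### Rounding a set to a union of cells -/

/-- A set fills more than half of a cell. -/
def IsMajority (b : Module.Basis (Fin d) ℝ (Vd d)) (M : ℕ) (F : Set (Vd d))
    (k : Fin d → ℤ) : Prop :=
  volume (cell b M k) < 2 * volume (F ∩ cell b M k)

/-- The union of the cells of which `F` fills more than half. -/
def roundSet (b : Module.Basis (Fin d) ℝ (Vd d)) (M : ℕ) (F : Set (Vd d)) : Set (Vd d) :=
  {x | IsMajority b M F (cellIdx b M x)}

lemma measurableSet_roundSet (b : Module.Basis (Fin d) ℝ (Vd d)) (M : ℕ) (F : Set (Vd d)) :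
    MeasurableSet (roundSet b M F) :=
  measurable_cellIdx b M (Set.to_countable {k | IsMajority b M F k}).measurableSet

lemma volume_symmDiff_roundSet_cell_le (b : Module.Basis (Fin d) ℝ (Vd d)) {M : ℕ}
    (hM : 0 < M) {F : Set (Vd d)} (hF : MeasurableSet F) (k : Fin d → ℤ) :
    volume (cell b M k) * volume ((F ∆ roundSet b M F) ∩ cell b M k) ≤
      2 * (volume (F ∩ cell b M k) * volume (cell b M k \ F)) := by
  have hadd : volume (F ∩ cell b M k) + volume (cell b M k \ F) = volume (cell b M k) := by
    rw [Set.inter_comm]; exact measure_inter_add_sdiff _ hF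
  by_cases h : IsMajority b M F k
  · have hsub : (F ∆ roundSet b M F) ∩ cell b M k ⊆ cell b M k \ F := by
      rintro x ⟨hx, hxk⟩
      refine ⟨hxk, fun hxF => ?_⟩
      have hxr : x ∈ roundSet b M F := by
        change IsMajority b M F (cellIdx b M x)
        rwa [show cellIdx b M x = k from hxk]
      rcases hx with hx | hx
      · exact hx.2 hxr
      · exact hx.2 hxF
    calc _ ≤ (2 * volume (F ∩ cell b M k)) * volume (cell b M k \ F) :=
          mul_le_mul' (le_of_lt h) (measure_mono hsub)
      _ = _ := mul_assoc _ _ _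
  · have hsub : (F ∆ roundSet b M F) ∩ cell b M k ⊆ F ∩ cell b M k := by
      rintro x ⟨hx, hxk⟩
      refine ⟨?_, hxk⟩
      rcases hx with hx | hx
      · exact hx.1
      · have hxr : IsMajority b M F (cellIdx b M x) := hx.1
        rw [show cellIdx b M x = k from hxk] at hxr
        exact absurd hxr h
    have hle : volume (F ∩ cell b M k) + volume (F ∩ cell b M k) ≤ volume (cell b M k) := by
      rw [← two_mul]; exact not_lt.1 h
    have hV : volume (cell b M k) ≤ 2 * volume (cell b M k \ F) := by
      have hfin : volume (F ∩ cell b M k) ≠ ⊤ :=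
        measure_ne_top_of_subset Set.inter_subset_right (by simp [volume_cell b hM])
      rw [← hadd] at hle ⊢
      rw [ENNReal.add_le_add_iff_left hfin] at hle
      rw [two_mul]
      exact add_le_add_left hle _
    calc _ ≤ (2 * volume (cell b M k \ F)) * volume (F ∩ cell b M k) :=
          mul_le_mul' hV (measure_mono hsub)
      _ = _ := by ring

lemma mul_volume_mul_volume_le_pairMeasure {s C : ℝ} (hs : 0 < s) (hC : 0 < C)
    {K : Vd d → ℝ≥0∞} (hK : IsKernel s C K) {r : ℝ} {A B : Set (Vd d)}
    (hA : MeasurableSet A) (hB : MeasurableSet B)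
    (hAB : ∀ x ∈ A, ∀ y ∈ B, x ≠ y ∧ ‖x - y‖ ≤ r) :
    ENNReal.ofReal (C * r ^ (-(d : ℝ) - s)) * (volume A * volume B) ≤ pairMeasure K (A ×ˢ B) := by
  rw [pairMeasure_prod hK.1.1 hA hB]
  calc _ = ∫⁻ _ in A, ∫⁻ _ in B, ENNReal.ofReal (C * r ^ (-(d : ℝ) - s)) := by
        simp only [setLIntegral_const]
        ring
    _ ≤ _ := by
      refine setLIntegral_mono' hA fun x hx => setLIntegral_mono' hB fun y hy => ?_
      obtain ⟨hne, hle⟩ := hAB x hx y hy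
      refine le_trans (ENNReal.ofReal_le_ofReal ?_) (hK.2 _ (sub_ne_zero.2 hne))
      refine mul_le_mul_of_nonneg_left ?_ hC.le
      refine Real.rpow_le_rpow_of_nonpos (norm_pos_iff.2 (sub_ne_zero.2 hne)) hle ?_
      have : (0 : ℝ) ≤ d := d.cast_nonneg
      linarith

/-- Sets of bounded perimeter are uniformly close to their roundings at small scales. -/
theorem exists_scale {s C : ℝ} (hs : 0 < s) (hC : 0 < C) {K : Vd d → ℝ≥0∞}
    (hK : IsKernel s C K) (b : Module.Basis (Fin d) ℝ (Vd d)) {B ε : ℝ≥0∞} (hB : B ≠ ⊤)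
    (hε : ε ≠ 0) :
    ∃ M : ℕ, 0 < M ∧ ∀ F : Set (Vd d), MeasurableSet F → nlPer K F ≤ B →
      volume (F ∆ roundSet b M F) ≤ ε := by
  obtain ⟨ρ, hρ, hcell⟩ := exists_norm_sub_le_of_cell b
  let q : ℕ → ℝ := fun M => C * (ρ / M) ^ (-(d : ℝ) - s)
  let V : ℕ → ℝ := fun M => covol b * (1 / M : ℝ) ^ d
  have hc := covol_pos b
  have hqV : ∀ M : ℕ, 0 < M → q M * V M = C * covol b * ρ ^ (-(d : ℝ) - s) * (M : ℝ) ^ s := by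
    intro M hM
    have hM' : (0 : ℝ) < M := by exact_mod_cast hM
    simp only [q, V]
    rw [Real.div_rpow hρ.le hM'.le, Real.rpow_sub hM', Real.rpow_neg hM'.le, Real.rpow_natCast,
      one_div,
      inv_pow]
    field_simp
  have htend : Tendsto (fun M : ℕ => ENNReal.ofReal (q M) * ENNReal.ofReal (V M)) atTop (𝓝 ⊤) := by
    have h1 : Tendsto (fun M : ℕ => C * covol b * ρ ^ (-(d : ℝ) - s) * (M : ℝ) ^ s) atTop atTop :=
      Tendsto.const_mul_atTop (by positivity)
        ((tendsto_rpow_atTop hs).comp tendsto_natCast_atTop_atTop)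
    refine (ENNReal.tendsto_ofReal_atTop.comp h1).congr' ?_
    filter_upwards [eventually_gt_atTop 0] with M hM
    rw [Function.comp_apply, ← hqV M hM, ENNReal.ofReal_mul]
    positivity
  have hlt : 2 * B / ε < ⊤ := ENNReal.div_lt_top (ENNReal.mul_ne_top (by simp) hB) hε
  obtain ⟨M, hMw, hM⟩ :=
    ((htend.eventually (eventually_gt_nhds hlt)).and (eventually_gt_atTop 0)).exists
  refine ⟨M, hM, fun F hF hFB => ?_⟩
  have hkey : ENNReal.ofReal (q M) * ENNReal.ofReal (V M) * volume (F ∆ roundSet b M F) ≤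
      2 * B := by
    rw [measure_eq_tsum_cell b M volume (hF.symmDiff (measurableSet_roundSet b M F)),
      ← ENNReal.tsum_mul_left]
    calc _ ≤ ∑' k, 2 * pairMeasure K ((F ∩ cell b M k) ×ˢ (cell b M k \ F)) := by
          refine ENNReal.tsum_le_tsum fun k => ?_
          have h1 := volume_symmDiff_roundSet_cell_le b hM hF k
          have h2 := mul_volume_mul_volume_le_pairMeasure hs hC hK (r := ρ / M)
            (hF.inter (measurableSet_cell b M k)) ((measurableSet_cell b M k).diff hF) (by
              rintro x ⟨hxF, hx⟩ y ⟨hy, hyF⟩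
              refine ⟨fun h => hyF (h ▸ hxF), hcell M hM x y ?_⟩
              exact (show cellIdx b M x = k from hx).trans (show cellIdx b M y = k from hy).symm)
          rw [volume_cell b hM] at h1
          rw [mul_assoc]
          refine (mul_le_mul_right h1 _).trans ?_
          rw [mul_left_comm]
          exact mul_le_mul_right h2 _
      _ = 2 * pairMeasure K (⋃ k, (F ∩ cell b M k) ×ˢ (cell b M k \ F)) := by
          rw [ENNReal.tsum_mul_left, measure_iUnion]
          · intro k l hkl
            refine Set.disjoint_left.2 ?_
            rintro ⟨x, y⟩ ⟨hx, -⟩ ⟨hx', -⟩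
            exact hkl (hx.2.symm.trans hx'.2)
          · exact fun k => (hF.inter (measurableSet_cell b M k)).prod
              ((measurableSet_cell b M k).diff hF)
      _ ≤ 2 * pairMeasure K (F ×ˢ Fᶜ) := by
          gcongr
          refine Set.iUnion_subset fun k => ?_
          rintro ⟨x, y⟩ ⟨hx, hy⟩
          exact ⟨hx.1, hy.2⟩
      _ ≤ _ := by
          rw [← nlPer_eq_pairMeasure hK.1.1 hF]
          gcongr
  by_contra! hcon
  refine absurd hMw (not_lt.2 ?_)
  rw [ENNReal.le_div_iff_mul_le (.inl hε) (.inr (ENNReal.mul_ne_top (by simp) hB))]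
  exact (mul_le_mul_right hcon.le _).trans hkey

/-! ### Compactness -/

/-- Countably many sequences of propositions are simultaneously eventually constant along a
subsequence. -/
lemma exists_subseq_eventually_const {ι : Type*} [Countable ι] (P : ℕ → ι → Prop) :
    ∃ φ : ℕ → ℕ, StrictMono φ ∧
      ∀ i, (∀ᶠ n in atTop, P (φ n) i) ∨ ∀ᶠ n in atTop, ¬ P (φ n) i := by
  classical
  obtain ⟨a, φ, hφ, h⟩ := CompactSpace.tendsto_subseq fun n => (fun i => decide (P n i) : ι → Bool)
  refine ⟨φ, hφ, fun i => ?_⟩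
  have hi := (tendsto_pi_nhds.1 h) i
  rw [nhds_discrete, tendsto_pure] at hi
  cases hai : a i
  · right
    filter_upwards [hi] with n hn
    simpa [hai] using hn
  · left
    filter_upwards [hi] with n hn
    simpa [hai] using hn

lemma eventually_const_of_eventually_iff_succ {P : ℕ → Prop}
    (h : ∀ᶠ n in atTop, (P n ↔ P (n + 1))) :
    (∀ᶠ n in atTop, P n) ∨ ∀ᶠ n in atTop, ¬ P n := by
  obtain ⟨m, hm⟩ := eventually_atTop.1 h
  have hc : ∀ n ≥ m, (P m ↔ P n) := fun n hn => by
    induction n, hn using Nat.le_induction with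
    | base => rfl
    | succ n hn ih => exact ih.trans (hm n hn)
  by_cases hP : P m
  · exact .inl (eventually_atTop.2 ⟨m, fun n hn => (hc n hn).1 hP⟩)
  · exact .inr (eventually_atTop.2 ⟨m, fun n hn hn' => hP ((hc n hn).2 hn')⟩)

lemma finite_image_cellIdx_unit_cell (b : Module.Basis (Fin d) ℝ (Vd d)) {M : ℕ} (hM : 0 < M)
    (k : Fin d → ℤ) : (cellIdx b M '' cell b 1 k).Finite := by
  refine (Set.finite_Icc (fun i => (M : ℤ) * k i) fun i => (M : ℤ) * (k i + 1)).subset ?_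
  rintro _ ⟨x, hx, rfl⟩
  have hx' : ∀ i, cellIdx b M x i / M = k i := fun i => by
    rw [← cellIdx_one_eq b hM]; exact congrFun hx i
  have hM' : (0 : ℤ) < M := by exact_mod_cast hM
  refine ⟨fun i => ?_, fun i => ?_⟩
  · have := Int.mul_ediv_self_le (x := cellIdx b M x i) hM'.ne'
    rwa [hx' i] at this
  · have := (Int.lt_mul_ediv_self_add (x := cellIdx b M x i) hM').le
    rw [hx' i] at this
    simp only
    linarith

/-- A sequence of countable families of sets of bounded perimeter has a subsequence converging
almost everywhere. -/
theorem exists_subseq_ae_eventually_const {s C : ℝ} (hs : 0 < s) (hC : 0 < C) {K : Vd d → ℝ≥0∞}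
    (hK : IsKernel s C K) (b : Module.Basis (Fin d) ℝ (Vd d)) {ι : Type*} [Countable ι]
    {F : ℕ → ι → Set (Vd d)} (hF : ∀ n i, MeasurableSet (F n i)) {B : ℝ≥0∞} (hB : B ≠ ⊤)
    (hFB : ∀ n i, nlPer K (F n i) ≤ B) :
    ∃ φ : ℕ → ℕ, StrictMono φ ∧ ∀ i, ∀ᵐ x,
      (∀ᶠ n in atTop, x ∈ F (φ n) i) ∨ ∀ᶠ n in atTop, x ∉ F (φ n) i := by
  obtain ⟨φ, hφ, hmaj⟩ := exists_subseq_eventually_const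
    fun n (q : ι × ℕ × (Fin d → ℤ)) => IsMajority b q.2.1 (F n q.1) q.2.2
  have hcauchy : ∀ (q : ι × (Fin d → ℤ)) (ε : ℝ≥0∞), ε ≠ 0 → ∀ᶠ n in atTop, ∀ m ≥ n,
      volume ((F (φ n) q.1 ∆ F (φ m) q.1) ∩ cell b 1 q.2) ≤ ε := by
    rintro ⟨i, k⟩ ε hε
    obtain ⟨M, hM, hround⟩ := exists_scale hs hC hK b hB (ENNReal.half_pos hε).ne'
    have hev : ∀ l ∈ cellIdx b M '' cell b 1 k, ∀ᶠ n in atTop, ∀ m ≥ n,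
        (IsMajority b M (F (φ n) i) l ↔ IsMajority b M (F (φ m) i) l) := by
      intro l _
      rcases hmaj (i, M, l) with h | h
      · filter_upwards [eventually_forall_ge_atTop.2 h] with n hn m hm
        exact iff_of_true (hn n le_rfl) (hn m hm)
      · filter_upwards [eventually_forall_ge_atTop.2 h] with n hn m hm
        exact iff_of_false (hn n le_rfl) (hn m hm)
    filter_upwards [(eventually_all_finite (finite_image_cellIdx_unit_cell b hM k)).2 hev]
      with n hn m hm
    have hsub : (F (φ n) i ∆ F (φ m) i) ∩ cell b 1 k ⊆
        (F (φ n) i ∆ roundSet b M (F (φ n) i)) ∪ (F (φ m) i ∆ roundSet b M (F (φ m) i)) := by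
      rintro x ⟨hx, hxk⟩
      have hiff : x ∈ roundSet b M (F (φ n) i) ↔ x ∈ roundSet b M (F (φ m) i) :=
        hn _ ⟨x, hxk, rfl⟩ m hm
      simp only [Set.mem_union, Set.mem_symmDiff] at hx ⊢
      tauto
    calc _ ≤ _ := measure_mono hsub
      _ ≤ _ := measure_union_le _ _
      _ ≤ ε / 2 + ε / 2 := add_le_add (hround _ (hF _ _) (hFB _ _)) (hround _ (hF _ _) (hFB _ _))
      _ = ε := ENNReal.add_halves ε
  have : Encodable (ι × (Fin d → ℤ)) := Encodable.ofCountable _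
  have hfin : ∀ n, {q : ι × (Fin d → ℤ) | Encodable.encode q ≤ n}.Finite := fun n =>
    (Set.finite_Iic n).preimage Encodable.encode_injective.injOn
  obtain ⟨ψ, hψ, hfast⟩ := extraction_forall_of_eventually (P := fun n k =>
    ∀ q ∈ {q : ι × (Fin d → ℤ) | Encodable.encode q ≤ n}, ∀ m ≥ k,
      volume ((F (φ k) q.1 ∆ F (φ m) q.1) ∩ cell b 1 q.2) ≤ 2⁻¹ ^ n)
    fun n => (eventually_all_finite (hfin n)).2 fun q _ => hcauchy q _ (by simp)
  refine ⟨φ ∘ ψ, hφ.comp hψ, fun i => ?_⟩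
  have hBC : ∀ k : Fin d → ℤ, ∀ᵐ x, ∀ᶠ n in atTop,
      x ∉ (F (φ (ψ n)) i ∆ F (φ (ψ (n + 1))) i) ∩ cell b 1 k := by
    intro k
    set e := Encodable.encode (i, k)
    have h1 : ∀ᵐ x, ∀ᶠ n in atTop,
        x ∉ (F (φ (ψ (n + e))) i ∆ F (φ (ψ (n + e + 1))) i) ∩ cell b 1 k := by
      refine ae_eventually_notMem (ne_top_of_le_ne_top ?_
        (ENNReal.tsum_le_tsum (g := fun n => 2⁻¹ ^ n)
        fun n => ?_))
      · rw [ENNReal.tsum_geometric]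
        simp
      · refine (hfast (n + e) (i, k) (Nat.le_add_left _ _) _
          (hψ.monotone (Nat.le_succ _))).trans ?_
        exact pow_le_pow_right_of_le_one' (by simp) (Nat.le_add_right _ _)
    filter_upwards [h1] with x hx
    rw [← map_add_atTop_eq_nat e]
    exact hx
  filter_upwards [ae_all_iff.2 hBC] with x hx
  refine eventually_const_of_eventually_iff_succ (P := fun n => x ∈ F (φ (ψ n)) i) ?_
  filter_upwards [hx (cellIdx b 1 x)] with n hn
  have : x ∉ F (φ (ψ n)) i ∆ F (φ (ψ (n + 1))) i := fun h => hn ⟨h, rfl⟩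
  rw [Set.mem_symmDiff] at this
  tauto

/-! ### Convex bodies have finite perimeter -/

lemma nlPer_eq_lintegral {K : Vd d → ℝ≥0∞} (hK : Measurable K) {E : Set (Vd d)}
    (hE : MeasurableSet E) :
    nlPer K E = ∫⁻ z, K z * volume {x | x ∈ E ∧ x - z ∉ E} := by
  have hmeas : Measurable fun p : Vd d × Vd d =>
      E.indicator (fun _ => (1 : ℝ≥0∞)) p.1 *
        (Eᶜ.indicator (fun _ => (1 : ℝ≥0∞)) (p.1 - p.2) * K p.2) := by
    have h1 : Measurable (E.indicator fun _ => (1 : ℝ≥0∞)) := measurable_const.indicator hE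
    have h2 : Measurable (Eᶜ.indicator fun _ => (1 : ℝ≥0∞)) := measurable_const.indicator hE.compl
    fun_prop
  have hset : ∀ z, MeasurableSet {x | x ∈ E ∧ x - z ∉ E} := fun z =>
    hE.inter ((measurable_sub_const z) hE.compl)
  calc nlPer K E
      = ∫⁻ x, ∫⁻ y, E.indicator (fun _ => (1 : ℝ≥0∞)) x *
          (Eᶜ.indicator (fun _ => (1 : ℝ≥0∞)) y * K (x - y)) := by
        unfold nlPer
        rw [← lintegral_indicator hE]
        refine lintegral_congr fun x => ?_
        by_cases hx : x ∈ E
        · simp only [hx, Set.indicator_of_mem, one_mul]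
          rw [← lintegral_indicator hE.compl]
          refine lintegral_congr fun y => ?_
          by_cases hy : y ∈ Eᶜ <;> simp [hy]
        · simp [hx]
    _ = ∫⁻ x, ∫⁻ z, E.indicator (fun _ => (1 : ℝ≥0∞)) x *
          (Eᶜ.indicator (fun _ => (1 : ℝ≥0∞)) (x - z) * K z) := by
        refine lintegral_congr fun x => ?_
        rw [← lintegral_sub_left_eq_self _ x]
        simp
    _ = ∫⁻ z, ∫⁻ x, E.indicator (fun _ => (1 : ℝ≥0∞)) x *
          (Eᶜ.indicator (fun _ => (1 : ℝ≥0∞)) (x - z) * K z) :=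
        lintegral_lintegral_swap hmeas.aemeasurable
    _ = _ := by
        refine lintegral_congr fun z => ?_
        rw [← setLIntegral_one, ← lintegral_indicator (hset z), ← lintegral_const_mul _
          (measurable_const.indicator (hset z))]
        refine lintegral_congr fun x => ?_
        by_cases hx : x ∈ E <;> by_cases hy : x - z ∈ E <;> simp [hx, hy]

lemma Convex.volume_diff_translate_le {E : Set (Vd d)} (hE : Convex ℝ E) (hfin : volume E ≠ ⊤)
    {x₀ : Vd d} {r : ℝ} (hr : 0 < r) (hball : Metric.ball x₀ r ⊆ E) {z : Vd d}
    (hz : ‖z‖ < r / 2) :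
    volume {x | x ∈ E ∧ x - z ∉ E} ≤ volume E * ENNReal.ofReal (2 * d / r * ‖z‖) := by
  rcases eq_or_ne z 0 with rfl | hz0
  · have : {x | x ∈ E ∧ x - 0 ∉ E} = ∅ := by ext x; simp
    rw [this]; simp
  have hzpos : 0 < ‖z‖ := norm_pos_iff.2 hz0
  set θ : ℝ := 2 * ‖z‖ / r with hθ
  have hθ0 : 0 < θ := by positivity
  have hθ1 : θ < 1 := by rw [hθ, div_lt_one hr]; linarith
  set H : Set (Vd d) := AffineMap.homothety x₀ (1 - θ) '' E with hH
  have hx₀ : x₀ ∈ E := hball (Metric.mem_ball_self hr)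
  have hHE : H ⊆ E := by
    rintro _ ⟨e, he, rfl⟩
    rw [AffineMap.homothety_eq_lineMap]
    exact hE.lineMap_mem hx₀ he ⟨by linarith, by linarith⟩
  have hHconv : Convex ℝ H := hE.affine_image _
  have hHvol : volume H = ENNReal.ofReal ((1 - θ) ^ d) * volume E := by
    rw [hH, Measure.addHaar_image_homothety, finrank_euclideanSpace_fin,
      abs_of_nonneg (pow_nonneg (by linarith) _)]
  have hsub : {x | x ∈ E ∧ x - z ∉ E} ⊆ E \ H := by
    rintro x ⟨hx, hxz⟩
    refine ⟨hx, ?_⟩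
    rintro ⟨e, he, rfl⟩
    refine hxz ?_
    have hy : x₀ - θ⁻¹ • z ∈ E := by
      refine hball ?_
      rw [Metric.mem_ball, dist_eq_norm, sub_sub_cancel_left, norm_neg, norm_smul,
        Real.norm_of_nonneg (by positivity), hθ]
      field_simp
      linarith
    have := hE hy he hθ0.le (by linarith : 0 ≤ 1 - θ) (by ring)
    convert this using 1
    rw [AffineMap.homothety_apply, smul_sub, smul_smul, mul_inv_cancel₀ hθ0.ne', vsub_eq_sub,
      vadd_eq_add, smul_sub, one_smul]
    module
  refine (measure_mono hsub).trans ?_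
  rw [measure_sdiff hHE (hHconv.nullMeasurableSet volume)
      (ne_top_of_le_ne_top hfin (measure_mono hHE)),
    hHvol, tsub_le_iff_right, mul_comm (volume E), ← add_mul,
    ← ENNReal.ofReal_add (by positivity) (pow_nonneg (by linarith) _)]
  refine le_mul_of_one_le_left' (ENNReal.one_le_ofReal.2 ?_)
  have hbern := one_add_mul_le_pow (a := -θ) (by linarith) d
  have : 2 * d / r * ‖z‖ = d * θ := by rw [hθ]; ring
  rw [this, sub_eq_add_neg]
  linarith

theorem Convex.nlPer_ne_top {K : Vd d → ℝ≥0∞} (hK : IsKernelBase K) {E : Set (Vd d)}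
    (hE : Convex ℝ E) (hmeas : MeasurableSet E) (hfin : volume E ≠ ⊤) {x₀ : Vd d} {r : ℝ}
    (hr : 0 < r) (hball : Metric.ball x₀ r ⊆ E) : nlPer K E ≠ ⊤ := by
  set ρ : ℝ := min (r / 2) 1 with hρ
  have hρ0 : 0 < ρ := lt_min (by linarith) one_pos
  set A : ℝ := 2 * d / r + 1 / ρ with hA
  have hA1 : 2 * d / r ≤ A := by rw [hA]; linarith [div_nonneg zero_le_one hρ0.le]
  have hA2 : 1 / ρ ≤ A := by
    have : 0 ≤ 2 * d / r := by positivity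
    linarith
  have hA0 : 0 ≤ A := (by positivity : (0 : ℝ) ≤ 1 / ρ).trans hA2
  have hbound : ∀ z, volume {x | x ∈ E ∧ x - z ∉ E} ≤
      volume E * ENNReal.ofReal A * ENNReal.ofReal (min 1 ‖z‖) := by
    intro z
    rw [mul_assoc, ← ENNReal.ofReal_mul hA0]
    by_cases hz : ‖z‖ < ρ
    · refine (hE.volume_diff_translate_le hfin hr hball (hz.trans_le (min_le_left _ _))).trans ?_
      rw [min_eq_right (hz.le.trans (min_le_right _ _))]
      gcongr
    · refine (measure_mono fun x hx => hx.1).trans (le_mul_of_one_le_right' ?_)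
      refine ENNReal.one_le_ofReal.2 ?_
      have h1 : ρ ≤ min 1 ‖z‖ := le_min (min_le_right _ _) (not_lt.1 hz)
      calc (1 : ℝ) = 1 / ρ * ρ := by field_simp
        _ ≤ _ := by gcongr
  rw [nlPer_eq_lintegral hK.1 hmeas]
  refine ne_top_of_le_ne_top (b := ∫⁻ z, volume E * ENNReal.ofReal A *
    (ENNReal.ofReal (min 1 ‖z‖) * K z)) ?_ (lintegral_mono fun z => ?_)
  · rw [lintegral_const_mul' _ _ (ENNReal.mul_ne_top hfin ENNReal.ofReal_ne_top)]
    exact ENNReal.mul_ne_top (ENNReal.mul_ne_top hfin ENNReal.ofReal_ne_top) hK.2.2.ne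
  · rw [mul_comm, ← mul_assoc]
    exact mul_le_mul_left (hbound z) _

lemma nlPer_box_ne_top {K : Vd d → ℝ≥0∞} (hK : IsKernelBase K)
    (b : Module.Basis (Fin d) ℝ (Vd d)) {α β : Fin d → ℝ} (h : ∀ i, α i < β i) :
    nlPer K (box b α β) ≠ ⊤ := by
  have hconv : Convex ℝ (box b α β) := by
    have : box b α β = ⋂ i, (b.coord i) ⁻¹' Set.Ico (α i) (β i) := by
      ext x; simp [box]
    rw [this]
    exact convex_iInter fun i => (convex_Ico _ _).linear_preimage _
  have hopen : IsOpen {x : Vd d | ∀ i, b.repr x i ∈ Set.Ioo (α i) (β i)} := by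
    simp only [Set.ofPred_forall]
    exact isOpen_iInter_of_finite fun i => isOpen_Ioo.preimage (continuous_repr b i)
  have hmem : (∑ i, ((α i + β i) / 2) • b i) ∈
      {x : Vd d | ∀ i, b.repr x i ∈ Set.Ioo (α i) (β i)} := by
    intro i
    rw [b.repr_sum_self]
    exact ⟨by linarith [h i], by linarith [h i]⟩
  obtain ⟨r, hr, hball⟩ := Metric.isOpen_iff.1 hopen _ hmem
  refine hconv.nlPer_ne_top hK (measurableSet_box b α β) ?_ hr
    (hball.trans fun x hx i => Set.Ioo_subset_Ico_self (hx i))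
  rw [volume_box]
  exact ENNReal.mul_ne_top ENNReal.ofReal_ne_top (ENNReal.prod_ne_top fun i _ => by simp)

/-! ### Packings and partitions of fundamental domains -/

lemma volume_preimage_add (g : Vd d) (A : Set (Vd d)) :
    volume {x | x + g ∈ A} = volume A :=
  measure_preimage_add_right volume g A

/-- The points of the unit cell having a lattice translate in `A`. -/
def proj (b : Module.Basis (Fin d) ℝ (Vd d)) (A : Set (Vd d)) : Set (Vd d) :=
  ⋃ k, {x | x + latVec b k ∈ A ∩ cell b 1 k}

lemma mem_proj {b : Module.Basis (Fin d) ℝ (Vd d)} {A : Set (Vd d)} {x : Vd d} :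
    x ∈ proj b A ↔ x ∈ cell b 1 0 ∧ ∃ k, x + latVec b k ∈ A := by
  simp only [proj, Set.mem_iUnion, Set.mem_ofPred_eq, Set.mem_inter_iff, cell, Set.mem_preimage,
    Set.mem_singleton_iff, cellIdx_one_add_latVec, add_eq_right]
  exact ⟨fun ⟨k, h1, h2⟩ => ⟨h2, k, h1⟩, fun ⟨h, k, hk⟩ => ⟨k, hk, h⟩⟩

lemma volume_proj_le (b : Module.Basis (Fin d) ℝ (Vd d)) {A : Set (Vd d)}
    (hA : MeasurableSet A) : volume (proj b A) ≤ volume A := by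
  rw [measure_eq_tsum_cell b 1 volume hA]
  refine (measure_iUnion_le _).trans (ENNReal.tsum_le_tsum fun k => ?_)
  rw [volume_preimage_add]

lemma measurableSet_proj (b : Module.Basis (Fin d) ℝ (Vd d)) {A : Set (Vd d)}
    (hA : MeasurableSet A) : MeasurableSet (proj b A) :=
  .iUnion fun k => measurable_add_const _ (hA.inter (measurableSet_cell b 1 k))

lemma volume_proj_eq (b : Module.Basis (Fin d) ℝ (Vd d)) {A : Set (Vd d)}
    (hA : MeasurableSet A) (hpack : ∀ x k, x ∈ A → x + latVec b k ∈ A → k = 0) :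
    volume (proj b A) = volume A := by
  rw [measure_eq_tsum_cell b 1 volume hA, proj, measure_iUnion]
  · exact tsum_congr fun k => volume_preimage_add _ _
  · intro k l hkl
    refine Set.disjoint_left.2 fun x hx hx' => hkl ?_
    have := hpack _ (l - k) hx.1 (by
      rw [add_assoc, ← map_add, add_sub_cancel]; exact hx'.1)
    exact (sub_eq_zero.1 this).symm
  · exact fun k => measurable_add_const _ (hA.inter (measurableSet_cell b 1 k))

/-- Measurable sets of prescribed volumes whose lattice translates are pairwise disjoint. -/
structure IsConfig (b : Module.Basis (Fin d) ℝ (Vd d)) {N : ℕ} (v : Fin N → ℝ)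
    (E : Fin N → Set (Vd d)) : Prop where
  measurable : ∀ i, MeasurableSet (E i)
  pack : ∀ i j k x, x ∈ E i → x + latVec b k ∈ E j → i = j ∧ k = 0
  volume_eq : ∀ i, volume (E i) = ENNReal.ofReal (v i)

lemma volume_iUnion_of_pack {b : Module.Basis (Fin d) ℝ (Vd d)} {N : ℕ} {E : Fin N → Set (Vd d)}
    (hE : ∀ i, MeasurableSet (E i))
    (hpack : ∀ i j k x, x ∈ E i → x + latVec b k ∈ E j → i = j ∧ k = 0) :
    volume (⋃ i, E i) = ∑ i, volume (E i) ∧ volume (proj b (⋃ i, E i)) = ∑ i, volume (E i) := by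
  have h1 : volume (⋃ i, E i) = ∑ i, volume (E i) := by
    rw [measure_iUnion _ hE, tsum_fintype]
    intro i j hij
    refine Set.disjoint_left.2 fun x hx hx' => hij (hpack i j 0 x hx ?_).1
    simpa using hx'
  refine ⟨h1, ?_⟩
  rw [volume_proj_eq b (.iUnion hE), h1]
  intro x k hx hxk
  obtain ⟨i, hi⟩ := Set.mem_iUnion.1 hx
  obtain ⟨j, hj⟩ := Set.mem_iUnion.1 hxk
  exact (hpack i j k x hi hj).2

lemma volume_add_latVec_iUnion_compl_eq_zero {b : Module.Basis (Fin d) ℝ (Vd d)}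
    {D : Set (Vd d)} (h : volume (cell b 1 0 \ proj b D) = 0) :
    volume (Set.univ \ ⋃ g ∈ latticeOf b, setTranslate g D) = 0 := by
  refine measure_mono_null (t := ⋃ k, {x | x + latVec b k ∈ cell b 1 0 \ proj b D}) ?_
    (measure_iUnion_null fun k => by rw [volume_preimage_add, h])
  rintro x ⟨-, hx⟩
  refine Set.mem_iUnion.2 ⟨-cellIdx b 1 x, ?_, fun hx' => hx ?_⟩
  · change cellIdx b 1 (x + latVec b (-cellIdx b 1 x)) = 0
    rw [cellIdx_one_add_latVec, add_neg_cancel]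
  · obtain ⟨k, hk⟩ := (mem_proj.1 hx').2
    set y := x + latVec b (-cellIdx b 1 x) + latVec b k
    refine Set.mem_iUnion₂.2 ⟨latVec b (cellIdx b 1 x - k), ⟨_, rfl⟩, y, hk, ?_⟩
    simp only [y, map_sub, map_neg]
    abel

theorem IsConfig.isFundDom_and_admissible {b : Module.Basis (Fin d) ℝ (Vd d)} {N : ℕ}
    {v : Fin N → ℝ} {E : Fin N → Set (Vd d)} (h : IsConfig b v E) (hv : ∀ i, 0 < v i)
    (hsum : ∑ i, v i = covol b) :
    IsFundDom (latticeOf b) (⋃ i, E i) ∧ AdmissiblePart (⋃ i, E i) v E := by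
  have hvol := (volume_iUnion_of_pack h.measurable h.pack).2
  have hD := MeasurableSet.iUnion h.measurable
  refine ⟨⟨hD, ?_, volume_add_latVec_iUnion_compl_eq_zero ?_⟩, h.measurable,
    fun i => Set.subset_iUnion E i, h.volume_eq, ?_, by simp⟩
  · rintro _ ⟨k, rfl⟩ hk
    change latVec b k ≠ 0 at hk
    have hempty : setTranslate (latVec b k) (⋃ i, E i) ∩ ⋃ i, E i = ∅ := by
      rw [Set.eq_empty_iff_forall_notMem]
      rintro _ ⟨⟨x, hx, rfl⟩, hx'⟩
      obtain ⟨i, hi⟩ := Set.mem_iUnion.1 hx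
      obtain ⟨j, hj⟩ := Set.mem_iUnion.1 hx'
      exact hk (by rw [(h.pack i j k x hi hj).2, map_zero])
    exact (congrArg volume hempty).trans measure_empty
  · have hsub : proj b (⋃ i, E i) ⊆ cell b 1 0 := fun x hx => (mem_proj.1 hx).1
    have hc : volume (cell b 1 0) = volume (proj b (⋃ i, E i)) := by
      rw [hvol, volume_unit_cell, ← hsum, ENNReal.ofReal_sum_of_nonneg fun i _ => (hv i).le]
      exact Finset.sum_congr rfl fun i _ => (h.volume_eq i).symm
    rw [measure_sdiff hsub (measurableSet_proj b hD).nullMeasurableSet, hc, tsub_self]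
    rw [← hc, volume_unit_cell]
    exact ENNReal.ofReal_ne_top
  · intro i j hij
    have : E i ∩ E j = ∅ := by
      rw [Set.eq_empty_iff_forall_notMem]
      rintro x ⟨hx, hx'⟩
      exact hij (h.pack i j 0 x hx (by simpa using hx')).1
    rw [this, measure_empty]

theorem exists_isConfig_of_admissible {b : Module.Basis (Fin d) ℝ (Vd d)} {N : ℕ}
    {v : Fin N → ℝ} {D : Set (Vd d)} {E : Fin N → Set (Vd d)} (hD : IsFundDom (latticeOf b) D)
    (hE : AdmissiblePart D v E) :
    ∃ E' : Fin N → Set (Vd d), IsConfig b v E' ∧ (∀ i, E' i =ᵐ[volume] E i) ∧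
      (⋃ i, E' i : Set (Vd d)) =ᵐ[volume] D := by
  obtain ⟨hm, hsub, hvol, hdisj, hcov⟩ := hE
  let Z : Set (Vd d) := ⋃ (i) (j) (k) (_ : ¬ (i = j ∧ k = 0)), E i ∩ {x | x + latVec b k ∈ E j}
  have hZm : MeasurableSet Z := .iUnion fun i => .iUnion fun j => .iUnion fun k =>
    .iUnion fun _ => (hm i).inter (measurable_add_const _ (hm j))
  have hZ : volume Z = 0 := by
    refine measure_iUnion_null fun i => measure_iUnion_null fun j => measure_iUnion_null fun k =>
      measure_iUnion_null fun hijk => ?_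
    by_cases hk : k = 0
    · subst hk
      simpa using hdisj i j fun h => hijk ⟨h, rfl⟩
    · have h0 := hD.2.1 (latVec b k) ⟨k, rfl⟩ ((map_ne_zero_iff _ (latVec_injective b)).2 hk)
      rw [← volume_preimage_add (latVec b k)] at h0
      refine measure_mono_null ?_ h0
      rintro x ⟨hx, hx'⟩
      exact ⟨⟨x, hsub i hx, rfl⟩, hsub j hx'⟩
  have hae : ∀ i, (E i \ Z : Set (Vd d)) =ᵐ[volume] E i := fun i => sdiff_null_ae_eq_self hZ
  refine ⟨fun i => E i \ Z, ⟨fun i => (hm i).diff hZm, ?_, fun i => ?_⟩, hae, ?_⟩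
  · intro i j k x hx hxk
    by_contra hcon
    refine hx.2 (Set.mem_iUnion.2 ⟨i, Set.mem_iUnion.2 ⟨j, Set.mem_iUnion₂.2 ⟨k, hcon, hx.1, ?_⟩⟩⟩)
    exact hxk.1
  · rw [measure_congr (hae i), hvol]
  · refine (Filter.EventuallyEq.countable_iUnion hae).trans ?_
    refine ae_eq_set.2 ⟨?_, hcov⟩
    rw [Set.sdiff_eq_empty.2 (Set.iUnion_subset hsub), measure_empty]

theorem exists_isConfig_nlPer_ne_top (hd : 1 ≤ d) {K : Vd d → ℝ≥0∞} (hK : IsKernelBase K)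
    (b : Module.Basis (Fin d) ℝ (Vd d)) {N : ℕ} {v : Fin N → ℝ} (hv : ∀ i, 0 < v i)
    (hsum : ∑ i, v i = covol b) :
    ∃ E : Fin N → Set (Vd d), IsConfig b v E ∧ ∀ i, nlPer K (E i) ≠ ⊤ := by
  classical
  have hc := covol_pos b
  let i₀ : Fin d := ⟨0, hd⟩
  let lo : Fin N → ℝ := fun i => (∑ j ∈ Finset.Iio i, v j) / covol b
  let hi : Fin N → ℝ := fun i => (∑ j ∈ Finset.Iic i, v j) / covol b
  have hhi : ∀ i, hi i = lo i + v i / covol b := by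
    intro i
    simp only [hi, lo]
    rw [← Finset.Iio_insert, Finset.sum_insert (by simp)]
    ring
  have hlt : ∀ i, lo i < hi i := fun i => by
    rw [hhi]; linarith [div_pos (hv i) hc]
  have hle : ∀ i j, i < j → hi i ≤ lo j := by
    intro i j hij
    refine div_le_div_of_nonneg_right ?_ hc.le
    refine Finset.sum_le_sum_of_subset_of_nonneg ?_ fun k _ _ => (hv k).le
    intro k hk
    exact Finset.mem_Iio.2 ((Finset.mem_Iic.1 hk).trans_lt hij)
  have hlo0 : ∀ i, 0 ≤ lo i := fun i =>
    div_nonneg (Finset.sum_nonneg fun k _ => (hv k).le) hc.le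
  have hhi1 : ∀ i, hi i ≤ 1 := fun i => by
    refine (div_le_one hc).2 ?_
    rw [← hsum]
    exact Finset.sum_le_sum_of_subset_of_nonneg (Finset.subset_univ _) fun k _ _ => (hv k).le
  let α : Fin N → Fin d → ℝ := fun i => Function.update 0 i₀ (lo i)
  let β : Fin N → Fin d → ℝ := fun i => Function.update 1 i₀ (hi i)
  have hαβ : ∀ i t, α i t < β i t := by
    intro i t
    by_cases ht : t = i₀
    · subst ht; simpa [α, β] using hlt i
    · simp [α, β, ht]
  have hunit : ∀ i, box b (α i) (β i) ⊆ cell b 1 0 := by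
    intro i x hx
    rw [cell_eq_box b one_pos]
    intro t
    have := hx t
    by_cases ht : t = i₀
    · subst ht
      simp only [α, β, Function.update_self, Set.mem_Ico] at this
      simp only [Pi.zero_apply, Int.cast_zero, Nat.cast_one, Set.mem_Ico]
      exact ⟨by linarith [hlo0 i], by linarith [hhi1 i]⟩
    · simpa [α, β, ht] using this
  refine ⟨fun i => box b (α i) (β i), ⟨fun i => measurableSet_box b _ _, ?_, fun i => ?_⟩,
    fun i => nlPer_box_ne_top hK b (hαβ i)⟩
  · intro i j k x hx hxk
    have h0 : cellIdx b 1 x = 0 := hunit i hx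
    have h1 : cellIdx b 1 (x + latVec b k) = 0 := hunit j hxk
    have hk : k = 0 := by rwa [cellIdx_one_add_latVec, h0, zero_add] at h1
    refine ⟨?_, hk⟩
    subst hk
    rw [map_zero, add_zero] at hxk
    have hx1 := hx i₀
    have hx2 := hxk i₀
    simp only [α, β, Function.update_self, Set.mem_Ico] at hx1 hx2
    rcases lt_trichotomy i j with hij | hij | hij
    · linarith [hle i j hij]
    · exact hij
    · linarith [hle j i hij]
  · have : ∀ t, ENNReal.ofReal (β i t - α i t) =
        Function.update (1 : Fin d → ℝ≥0∞) i₀ (ENNReal.ofReal (v i / covol b)) t := by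
      intro t
      by_cases ht : t = i₀
      · subst ht; simp [α, β, hhi]
      · simp [α, β, ht]
    rw [volume_box, Finset.prod_congr rfl fun t _ => this t,
      Finset.prod_update_of_mem (Finset.mem_univ _)]
    simp only [Pi.one_apply, Finset.prod_const_one, mul_one]
    rw [← ENNReal.ofReal_mul hc.le, mul_div_cancel₀ _ hc.ne']

/-! ### Concentration of mass in boundedly many unit cells -/

lemma exists_card_le_of_isMajority (b : Module.Basis (Fin d) ℝ (Vd d)) {M : ℕ} (hM : 0 < M)
    {V : ℝ≥0∞} (hV : V ≠ ⊤) :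
    ∃ m : ℕ, ∀ F, MeasurableSet F → volume F ≤ V →
      ∃ S : Finset (Fin d → ℤ), S.card ≤ m ∧ ∀ k, IsMajority b M F k → k ∈ S := by
  have hM' : (0 : ℝ) < M := by exact_mod_cast hM
  set w : ℝ≥0∞ := ENNReal.ofReal (covol b * (1 / M : ℝ) ^ d) with hw
  have hw0 : w ≠ 0 := by
    have := covol_pos b
    rw [hw, Ne, ENNReal.ofReal_eq_zero, not_le]
    positivity
  have hc : 2 * V ≠ ⊤ := ENNReal.mul_ne_top (by simp) hV
  obtain ⟨m, hm⟩ := ENNReal.exists_nat_gt (ENNReal.div_ne_top hc hw0)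
  refine ⟨m, fun F hF hFV => ?_⟩
  have hle : ∑' k, 2 * volume (F ∩ cell b M k) ≤ 2 * V := by
    rw [ENNReal.tsum_mul_left, ← measure_eq_tsum_cell b M volume hF]
    gcongr
  obtain ⟨hf, hcard⟩ := ENNReal.finset_card_const_le_le_of_tsum_le hc hle hw0
  refine ⟨hf.toFinset, ?_, fun k hk => ?_⟩
  · exact_mod_cast hcard.trans hm.le
  · rw [Set.Finite.mem_toFinset, Set.mem_ofPred_eq, hw, ← volume_cell b hM k]
    exact hk.le

lemma exists_cover_roundSet (b : Module.Basis (Fin d) ℝ (Vd d)) {M : ℕ} (hM : 0 < M)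
    {V : ℝ≥0∞} (hV : V ≠ ⊤) :
    ∃ m : ℕ, ∀ F, MeasurableSet F → volume F ≤ V →
      ∃ g : ℕ → Fin d → ℤ, ∀ x ∈ roundSet b M F, ∃ p < m, cellIdx b 1 x = g p := by
  obtain ⟨m, hm⟩ := exists_card_le_of_isMajority b hM hV
  refine ⟨m, fun F hF hFV => ?_⟩
  obtain ⟨S, hS, hmem⟩ := hm F hF hFV
  let e := S.equivFin
  refine ⟨fun p i => if h : p < S.card then (e.symm ⟨p, h⟩ : Fin d → ℤ) i / M else 0,
    fun x hx => ?_⟩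
  have hxS := hmem _ hx
  refine ⟨e ⟨_, hxS⟩, (e ⟨_, hxS⟩).2.trans_le hS, ?_⟩
  ext i
  simp [cellIdx_one_eq b hM]

theorem exists_concentration {s C : ℝ} (hs : 0 < s) (hC : 0 < C) {K : Vd d → ℝ≥0∞}
    (hK : IsKernel s C K) (b : Module.Basis (Fin d) ℝ (Vd d)) {B V ε : ℝ≥0∞} (hB : B ≠ ⊤)
    (hV : V ≠ ⊤) (hε : ε ≠ 0) :
    ∃ m : ℕ, ∀ F, MeasurableSet F → volume F ≤ V → nlPer K F ≤ B →
      ∃ g : ℕ → Fin d → ℤ,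
        volume F ≤ volume (F ∩ {x | ∃ p < m, cellIdx b 1 x = g p}) + ε := by
  obtain ⟨M, hM, hround⟩ := exists_scale hs hC hK b hB hε
  obtain ⟨m, hm⟩ := exists_cover_roundSet b hM hV
  refine ⟨m, fun F hF hFV hFB => ?_⟩
  obtain ⟨g, hg⟩ := hm F hF hFV
  refine ⟨g, (measure_mono ?_).trans <| (measure_union_le _ _).trans <|
    add_le_add_right (hround F hF hFB) _⟩
  intro x hx
  by_cases hxr : x ∈ roundSet b M F
  · exact Or.inl ⟨hx, hg x hxr⟩
  · exact Or.inr (Or.inl ⟨hx, hxr⟩)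

/-! ### The limit configuration -/

/-- A sequence of configurations, all of whose translates by a countable family of lattice
vectors converge, which captures their mass, and whose relative positions either stabilize or
diverge. -/
structure IsConvergent (b : Module.Basis (Fin d) ℝ (Vd d)) {N : ℕ} (v : Fin N → ℝ) {J : Type*}
    (E : ℕ → Fin N → Set (Vd d)) (g : ℕ → J → Fin d → ℤ) : Prop where
  isConfig : ∀ n, IsConfig b v (E n)
  position : ∀ j l h, (∀ᶠ n in atTop, g n j = g n l + h) ∨ ∀ᶠ n in atTop, g n j ≠ g n l + h
  converge : ∀ i j, ∀ᵐ x, (∀ᶠ n in atTop, x + latVec b (g n j) ∈ E n i) ∨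
    ∀ᶠ n in atTop, x + latVec b (g n j) ∉ E n i
  capture : ∀ i (ε : ℝ≥0∞), ε ≠ 0 → ∃ T : Finset J, ∀ n,
    volume (E n i) ≤ volume (E n i ∩ {x | ∃ j ∈ T, cellIdx b 1 x = g n j}) + ε

/-- The limit of the translates of `E n i` by `-g n j`. -/
def limSet (b : Module.Basis (Fin d) ℝ (Vd d)) {N : ℕ} {J : Type*}
    (E : ℕ → Fin N → Set (Vd d)) (g : ℕ → J → Fin d → ℤ) (i : Fin N) (j : J) : Set (Vd d) :=
  {x | ∀ᶠ n in atTop, x + latVec b (g n j) ∈ E n i}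

/-- Two sequences of lattice vectors are equivalent if their difference is eventually constant. -/
def clusterSetoid {J : Type*} (g : ℕ → J → Fin d → ℤ) : Setoid J where
  r j l := ∃ h, ∀ᶠ n in atTop, g n j = g n l + h
  iseqv :=
    { refl := fun _ => ⟨0, by simp⟩
      symm := fun ⟨h, hh⟩ => ⟨-h, hh.mono fun n hn => by rw [hn, add_neg_cancel_right]⟩
      trans := fun ⟨h, hh⟩ ⟨h', hh'⟩ => ⟨h' + h, (hh.and hh').mono fun n hn => by
        rw [hn.1, hn.2, add_assoc]⟩ }

/-- The union over all clusters of the limits along them. -/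
def limConfig (b : Module.Basis (Fin d) ℝ (Vd d)) {N : ℕ} {J : Type*}
    (E : ℕ → Fin N → Set (Vd d)) (g : ℕ → J → Fin d → ℤ) (i : Fin N) : Set (Vd d) :=
  ⋃ q : Quotient (clusterSetoid g), limSet b E g i q.out

section

variable {b : Module.Basis (Fin d) ℝ (Vd d)} {N : ℕ} {v : Fin N → ℝ} {J : Type*}
  {E : ℕ → Fin N → Set (Vd d)} {g : ℕ → J → Fin d → ℤ}

lemma IsConvergent.eventually_mem_iff (h : IsConvergent b v E g) (i : Fin N) (j : J) :
    ∀ᵐ x, ∀ᶠ n in atTop, (x + latVec b (g n j) ∈ E n i ↔ x ∈ limSet b E g i j) := by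
  filter_upwards [h.converge i j] with x hx
  rcases hx with hx | hx
  · have hmem : x ∈ limSet b E g i j := hx
    exact hx.mono fun n hn => iff_of_true hn hmem
  · have hmem : x ∉ limSet b E g i j := fun h' => by
      obtain ⟨n, h1, h2⟩ := (h'.and hx).exists
      exact h2 h1
    exact hx.mono fun n hn => iff_of_false hn hmem

lemma IsConvergent.measurableSet_limSet (h : IsConvergent b v E g) (i : Fin N) (j : J) :
    MeasurableSet (limSet b E g i j) := by
  have : limSet b E g i j = ⋃ m, ⋂ n ≥ m, {x | x + latVec b (g n j) ∈ E n i} := by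
    ext x
    simp [limSet, eventually_atTop]
  rw [this]
  exact .iUnion fun m => .iInter fun n => .iInter fun _ =>
    measurable_add_const _ ((h.isConfig n).measurable i)

lemma IsConvergent.measurableSet_limConfig [Countable J] (h : IsConvergent b v E g) (i : Fin N) :
    MeasurableSet (limConfig b E g i) :=
  .iUnion fun q => h.measurableSet_limSet i q.out

lemma IsConvergent.eventually_ne_add (h : IsConvergent b v E g)
    {q r : Quotient (clusterSetoid g)} (hqr : q ≠ r) (k : Fin d → ℤ) :
    ∀ᶠ n in atTop, g n q.out ≠ g n r.out + k := by
  refine (h.position _ _ k).resolve_left fun hk => hqr ?_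
  rw [← q.out_eq, ← r.out_eq]
  exact Quotient.sound ⟨k, hk⟩

lemma IsConvergent.pack (h : IsConvergent b v E g) (i j : Fin N) (k : Fin d → ℤ) (x : Vd d)
    (hx : x ∈ limConfig b E g i) (hxk : x + latVec b k ∈ limConfig b E g j) :
    i = j ∧ k = 0 := by
  obtain ⟨q, hq⟩ := Set.mem_iUnion.1 hx
  obtain ⟨r, hr⟩ := Set.mem_iUnion.1 hxk
  have key : ∀ᶠ n in atTop, i = j ∧ k + g n r.out - g n q.out = 0 := by
    filter_upwards [hq, hr] with n hn hn'
    refine (h.isConfig n).pack i j _ _ hn ?_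
    convert hn' using 1
    rw [map_sub, map_add]
    abel
  obtain rfl | hqr := eq_or_ne q r
  · obtain ⟨n, h1, h2⟩ := key.exists
    exact ⟨h1, by simpa using h2⟩
  · obtain ⟨n, h1, h2⟩ := (key.and (h.eventually_ne_add hqr k)).exists
    exact absurd (by rw [← sub_eq_zero.1 h1.2, add_comm]) h2

lemma exists_add_mem_limConfig {i : Fin N} {j : J} {x : Vd d} (hx : x ∈ limSet b E g i j) :
    ∃ k, x + latVec b k ∈ limConfig b E g i := by
  obtain ⟨k, hk⟩ := Quotient.mk_out (s := clusterSetoid g) j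
  refine ⟨-k, Set.mem_iUnion.2 ⟨Quotient.mk (clusterSetoid g) j, ?_⟩⟩
  filter_upwards [hx, hk] with n hn hkn
  rw [hkn, add_assoc, ← map_add]
  convert hn using 4
  abel

lemma IsConvergent.volume_le_limConfig [Countable J] (h : IsConvergent b v E g) (i : Fin N) :
    ENNReal.ofReal (v i) ≤ volume (limConfig b E g i) := by
  refine ENNReal.le_of_forall_pos_le_add fun ε hε _ => ?_
  obtain ⟨T, hT⟩ := h.capture i ε (by exact_mod_cast hε.ne')
  let U : ℕ → Set (Vd d) := fun n => cell b 1 0 ∩ ⋃ j ∈ T, {x | x + latVec b (g n j) ∈ E n i}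
  let U' : Set (Vd d) := cell b 1 0 ∩ ⋃ j ∈ T, limSet b E g i j
  have hUm : ∀ n, MeasurableSet (U n) := fun n => (measurableSet_cell b 1 0).inter <|
    T.measurableSet_biUnion fun j _ => measurable_add_const _ ((h.isConfig n).measurable i)
  have hUm' : MeasurableSet U' := (measurableSet_cell b 1 0).inter <|
    T.measurableSet_biUnion fun j _ => h.measurableSet_limSet i j
  have hlim : Tendsto (fun n => volume (U n)) atTop (𝓝 (volume U')) := by
    refine tendsto_measure_of_ae_tendsto_indicator atTop hUm' hUm (measurableSet_cell b 1 0)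
      (by rw [volume_unit_cell]; exact ENNReal.ofReal_ne_top)
      (Eventually.of_forall fun n => Set.inter_subset_left) ?_
    have hall : ∀ᵐ x, ∀ j ∈ T, ∀ᶠ n in atTop,
        (x + latVec b (g n j) ∈ E n i ↔ x ∈ limSet b E g i j) :=
      (ae_ball_iff T.countable_toSet).2 fun j _ => h.eventually_mem_iff i j
    filter_upwards [hall] with x hx
    filter_upwards [(Finset.eventually_all T).2 hx] with n hn
    simp only [U, U', Set.mem_inter_iff, Set.mem_iUnion, Set.mem_ofPred_eq]
    refine and_congr_right fun _ => exists_congr fun j => ?_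
    exact ⟨fun ⟨hj, hx⟩ => ⟨hj, (hn j hj).1 hx⟩, fun ⟨hj, hx⟩ => ⟨hj, (hn j hj).2 hx⟩⟩
  have hlower : ∀ n, ENNReal.ofReal (v i) ≤ volume (U n) + ε := by
    intro n
    rw [← (h.isConfig n).volume_eq i]
    refine (hT n).trans (add_le_add_left ?_ _)
    set A := E n i ∩ {x | ∃ j ∈ T, cellIdx b 1 x = g n j} with hA
    have hAm : MeasurableSet A := by
      refine ((h.isConfig n).measurable i).inter ?_
      have : {x | ∃ j ∈ T, cellIdx b 1 x = g n j} = ⋃ j ∈ T, cell b 1 (g n j) := by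
        ext x; simp [cell]
      rw [this]
      exact T.measurableSet_biUnion fun j _ => measurableSet_cell b 1 _
    rw [← volume_proj_eq b hAm fun x k hx hxk => ((h.isConfig n).pack i i k x hx.1 hxk.1).2]
    refine measure_mono fun x hx => ?_
    obtain ⟨hx0, k, hk, j, hj, hkj⟩ := mem_proj.1 hx
    refine ⟨hx0, Set.mem_iUnion₂.2 ⟨j, hj, ?_⟩⟩
    have hx0' : cellIdx b 1 x = 0 := hx0
    rw [cellIdx_one_add_latVec, hx0', zero_add] at hkj
    rwa [hkj] at hk
  have hle := ge_of_tendsto' (hlim.add_const (ε : ℝ≥0∞)) hlower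
  refine hle.trans (add_le_add_left ((measure_mono ?_).trans
    (volume_proj_le b (h.measurableSet_limConfig i))) _)
  rintro x ⟨hx0, hx⟩
  obtain ⟨j, -, hj⟩ := Set.mem_iUnion₂.1 hx
  exact mem_proj.2 ⟨hx0, exists_add_mem_limConfig hj⟩

theorem IsConvergent.isConfig_limConfig [Countable J] (h : IsConvergent b v E g)
    (hv : ∀ i, 0 < v i) (hsum : ∑ i, v i = covol b) : IsConfig b v (limConfig b E g) := by
  refine ⟨h.measurableSet_limConfig, h.pack, fun i => ?_⟩
  have hvol := (volume_iUnion_of_pack h.measurableSet_limConfig h.pack).2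
  have hle : ∑ i, volume (limConfig b E g i) ≤ ∑ i, ENNReal.ofReal (v i) := by
    rw [← hvol, ← ENNReal.ofReal_sum_of_nonneg fun i _ => (hv i).le, hsum, ← volume_unit_cell b 0]
    exact measure_mono fun x hx => (mem_proj.1 hx).1
  refine le_antisymm ?_ (h.volume_le_limConfig i)
  rw [← Finset.add_sum_erase _ _ (Finset.mem_univ i),
    ← Finset.add_sum_erase _ (fun i => ENNReal.ofReal (v i)) (Finset.mem_univ i)] at hle
  refine (ENNReal.add_le_add_iff_right (a := ∑ j ∈ Finset.univ.erase i, ENNReal.ofReal (v j))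
    (by simp)).1 (le_trans ?_ hle)
  gcongr with j
  exact h.volume_le_limConfig j

lemma IsConvergent.tendsto_norm_sub (h : IsConvergent b v E g)
    {q r : Quotient (clusterSetoid g)} (hqr : q ≠ r) :
    Tendsto (fun n => ‖latVec b (g n q.out) - latVec b (g n r.out)‖) atTop atTop := by
  simp_rw [← map_sub]
  refine (tendsto_norm_latVec b).comp
    (le_cofinite_iff_eventually_ne.2 fun k => eventually_map.2 ?_)
  filter_upwards [h.eventually_ne_add hqr k] with n hn hk
  exact hn (sub_eq_iff_eq_add'.1 hk)

theorem IsConvergent.nlPer_limConfig_le [Countable J] (h : IsConvergent b v E g)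
    {K : Vd d → ℝ≥0∞} (hK : Measurable K) (i : Fin N) {a : ℝ≥0∞}
    (ha : Tendsto (fun n => nlPer K (E n i)) atTop (𝓝 a)) : nlPer K (limConfig b E g i) ≤ a := by
  have hm : ∀ q : Quotient (clusterSetoid g), MeasurableSet (limSet b E g i q.out) :=
    fun q => h.measurableSet_limSet i q.out
  refine (nlPer_iUnion_le hK hm).trans <|
    tsum_nlPer_le_of_tendsto hK (F := fun n => E n i) (fun n => (h.isConfig n).measurable i)
      (g := fun n (q : Quotient (clusterSetoid g)) => latVec b (g n q.out))
      hm (fun _ _ hqr => h.tendsto_norm_sub hqr) (fun q => h.eventually_mem_iff i q.out) ha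

theorem IsConvergent.nlPer_iUnion_limConfig_le [Countable J] (h : IsConvergent b v E g)
    {K : Vd d → ℝ≥0∞} (hK : Measurable K) {a : ℝ≥0∞}
    (ha : Tendsto (fun n => nlPer K (⋃ i, E n i)) atTop (𝓝 a)) :
    nlPer K (⋃ i, limConfig b E g i) ≤ a := by
  have hm : ∀ q : Quotient (clusterSetoid g), MeasurableSet (⋃ i, limSet b E g i q.out) :=
    fun q => .iUnion fun i => h.measurableSet_limSet i q.out
  have hswap : ⋃ i, limConfig b E g i =
      ⋃ q : Quotient (clusterSetoid g), ⋃ i, limSet b E g i q.out := Set.iUnion_comm _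
  rw [hswap]
  refine (nlPer_iUnion_le hK hm).trans <|
    tsum_nlPer_le_of_tendsto hK (F := fun n => ⋃ i, E n i)
      (fun n => .iUnion (h.isConfig n).measurable)
      (g := fun n (q : Quotient (clusterSetoid g)) => latVec b (g n q.out))
      hm (fun _ _ hqr => h.tendsto_norm_sub hqr) (fun q => ?_) ha
  filter_upwards [ae_all_iff.2 fun i => h.eventually_mem_iff i q.out] with x hx
  filter_upwards [eventually_all.2 hx] with n hn
  simp only [Set.mem_iUnion, hn]

end

theorem exists_isConvergent_subseq {s C : ℝ} (hs : 0 < s) (hC : 0 < C) {K : Vd d → ℝ≥0∞}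
    (hK : IsKernel s C K) {b : Module.Basis (Fin d) ℝ (Vd d)} {N : ℕ} {v : Fin N → ℝ}
    {E : ℕ → Fin N → Set (Vd d)} (hE : ∀ n, IsConfig b v (E n)) {B : ℝ≥0∞} (hB : B ≠ ⊤)
    (hEB : ∀ n i, nlPer K (E n i) ≤ B) :
    ∃ φ : ℕ → ℕ, StrictMono φ ∧ ∃ g : ℕ → Fin N × ℕ × ℕ → Fin d → ℤ,
      IsConvergent b v (fun n => E (φ n)) g := by
  choose m hm using fun (i : Fin N) (k : ℕ) =>
    exists_concentration hs hC hK b (V := ENNReal.ofReal (v i)) (ε := (k : ℝ≥0∞)⁻¹) hB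
      ENNReal.ofReal_ne_top (by simp)
  choose g hg using fun (n : ℕ) (i : Fin N) (k : ℕ) =>
    hm i k (E n i) ((hE n).measurable i) ((hE n).volume_eq i).le (hEB n i)
  obtain ⟨φ, hφ, hpos⟩ := exists_subseq_eventually_const
    fun n (p : (Fin N × ℕ × ℕ) × (Fin N × ℕ × ℕ) × (Fin d → ℤ)) =>
      g n p.1.1 p.1.2.1 p.1.2.2 = g n p.2.1.1 p.2.1.2.1 p.2.1.2.2 + p.2.2
  obtain ⟨ψ, hψ, hconv⟩ := exists_subseq_ae_eventually_const hs hC hK b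
    (F := fun n (p : Fin N × Fin N × ℕ × ℕ) =>
      (fun x => x + latVec b (g (φ n) p.2.1 p.2.2.1 p.2.2.2)) ⁻¹' E (φ n) p.1)
    (fun n p => measurable_add_const _ ((hE _).measurable _)) hB
    (fun n p => (nlPer_preimage_add hK.1.1 _ ((hE _).measurable _)).trans_le (hEB _ _))
  refine ⟨φ ∘ ψ, hφ.comp hψ, fun n p => g (φ (ψ n)) p.1 p.2.1 p.2.2, fun n => hE _, ?_, ?_, ?_⟩
  · intro j l h
    exact (hpos (j, l, h)).imp hψ.tendsto_atTop.eventually hψ.tendsto_atTop.eventually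
  · exact fun i j => hconv (i, j)
  · intro i ε hε
    obtain ⟨k, hk⟩ := ENNReal.exists_inv_nat_lt hε
    refine ⟨(Finset.range (m i k)).image fun p => (i, k, p), fun n => ?_⟩
    refine (hg (φ (ψ n)) i k).trans (add_le_add (measure_mono ?_) hk.le)
    rintro x ⟨hx, p, hp, hxp⟩
    exact ⟨hx, _, Finset.mem_image_of_mem _ (Finset.mem_range.2 hp), hxp⟩

/-! ### Existence of minimizers -/

theorem exists_isConfig_energy_le {s C : ℝ} (hs : 0 < s) (hC : 0 < C) {K : Vd d → ℝ≥0∞}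
    (hK : IsKernel s C K) {b : Module.Basis (Fin d) ℝ (Vd d)} {N : ℕ} {v : Fin N → ℝ}
    (hv : ∀ i, 0 < v i) (hsum : ∑ i, v i = covol b) {μ m : ℝ≥0∞} (hμ : μ ≠ ⊤) (hm : m ≠ ⊤)
    {E : ℕ → Fin N → Set (Vd d)} (hE : ∀ n, IsConfig b v (E n))
    (hlim : Tendsto (fun n => μ * nlPer K (⋃ i, E n i) + 2⁻¹ * ∑ i, nlPer K (E n i)) atTop
      (𝓝 m)) :
    ∃ E' : Fin N → Set (Vd d), IsConfig b v E' ∧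
      μ * nlPer K (⋃ i, E' i) + 2⁻¹ * ∑ i, nlPer K (E' i) ≤ m := by
  obtain ⟨n₀, hn₀⟩ := eventually_atTop.1
    (hlim.eventually_le_const (ENNReal.lt_add_right hm one_ne_zero))
  have hB : ∀ n i, nlPer K (E (n + n₀) i) ≤ 2 * (m + 1) := by
    intro n i
    calc nlPer K (E (n + n₀) i) ≤ ∑ i, nlPer K (E (n + n₀) i) :=
        Finset.single_le_sum (f := fun i => nlPer K (E (n + n₀) i)) (fun _ _ => zero_le)
          (Finset.mem_univ i)
      _ = 2 * (2⁻¹ * ∑ i, nlPer K (E (n + n₀) i)) := by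
        rw [← mul_assoc, ENNReal.mul_inv_cancel two_ne_zero ENNReal.ofNat_ne_top, one_mul]
      _ ≤ 2 * (m + 1) := by
        gcongr
        exact le_add_self.trans (hn₀ _ (Nat.le_add_left _ _))
  obtain ⟨a, χ, hχ, ha⟩ := CompactSpace.tendsto_subseq fun n =>
    (nlPer K (⋃ i, E (n + n₀) i), fun i => nlPer K (E (n + n₀) i))
  obtain ⟨φ, hφ, g, hg⟩ := exists_isConvergent_subseq hs hC hK (fun n => hE (χ n + n₀))
    (ENNReal.mul_ne_top ENNReal.ofNat_ne_top (ENNReal.add_ne_top.2 ⟨hm, ENNReal.one_ne_top⟩))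
    (fun n => hB (χ n))
  have h1 := (continuous_fst.tendsto a).comp ha
  have h2 : ∀ i, Tendsto (fun n => nlPer K (E (χ n + n₀) i)) atTop (𝓝 (a.2 i)) := fun i =>
    (((continuous_apply i).comp continuous_snd).tendsto a).comp ha
  have ham : μ * a.1 + 2⁻¹ * ∑ i, a.2 i = m := by
    refine tendsto_nhds_unique ?_
      (hlim.comp ((tendsto_add_atTop_nat n₀).comp hχ.tendsto_atTop))
    exact (ENNReal.Tendsto.const_mul h1 (Or.inr hμ)).add
      (ENNReal.Tendsto.const_mul (tendsto_finsetSum _ fun i _ => h2 i) (Or.inr (by simp)))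
  refine ⟨_, hg.isConfig_limConfig hv hsum, ham.symm ▸ ?_⟩
  gcongr with i
  · exact hg.nlPer_iUnion_limConfig_le hK.1.1 (h1.comp hφ.tendsto_atTop)
  · exact hg.nlPer_limConfig_le hK.1.1 i ((h2 i).comp hφ.tendsto_atTop)

theorem stmt1 {d : ℕ} (hd : 1 ≤ d) (s C : ℝ) (hs : s ∈ Set.Ioo (0:ℝ) 1) (hC : 0 < C)
    (K : Vd d → ℝ≥0∞) (hK : IsKernel s C K)
    (L μ : ℝ) (hL : 0 < L) (hμ : 0 ≤ μ)
    (G : Set (Vd d)) (hG : IsLatticeWithVol G (L ^ d))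
    (N : ℕ) (v : Fin N → ℝ) (hv : ∀ i, 0 < v i) (hsum : ∑ i, v i = L ^ d) :
    sInf {c : ℝ≥0∞ | ∃ (D : Set (Vd d)) (E : Fin N → Set (Vd d)),
        IsFundDom G D ∧ AdmissiblePart D v E ∧
        c = ENNReal.ofReal μ * nlPer K D + 2⁻¹ * ∑ i, nlPer K (E i)} ≠ ⊤ ∧
    ∃ (D : Set (Vd d)) (E : Fin N → Set (Vd d)), IsFundDom G D ∧ AdmissiblePart D v E ∧
      ENNReal.ofReal μ * nlPer K D + 2⁻¹ * ∑ i, nlPer K (E i) =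
        sInf {c : ℝ≥0∞ | ∃ (D' : Set (Vd d)) (E' : Fin N → Set (Vd d)),
          IsFundDom G D' ∧ AdmissiblePart D' v E' ∧
          c = ENNReal.ofReal μ * nlPer K D' + 2⁻¹ * ∑ i, nlPer K (E' i)} := by
  obtain ⟨b', hli, rfl, hvol⟩ := hG
  have : Nonempty (Fin d) := ⟨⟨0, hd⟩⟩
  obtain ⟨b, rfl⟩ : ∃ b : Module.Basis (Fin d) ℝ (Vd d), ⇑b = b' :=
    ⟨basisOfLinearIndependentOfCardEqFinrank hli (by simp),
      coe_basisOfLinearIndependentOfCardEqFinrank hli _⟩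
  have hsum' : ∑ i, v i = covol b := hsum.trans hvol.symm
  set S := {c : ℝ≥0∞ | ∃ (D : Set (Vd d)) (E : Fin N → Set (Vd d)),
    IsFundDom (latticeOf b) D ∧ AdmissiblePart D v E ∧
    c = ENNReal.ofReal μ * nlPer K D + 2⁻¹ * ∑ i, nlPer K (E i)} with hS
  have hmem : ∀ E, IsConfig b v E →
      ENNReal.ofReal μ * nlPer K (⋃ i, E i) + 2⁻¹ * ∑ i, nlPer K (E i) ∈ S := fun E hE =>
    have h := hE.isFundDom_and_admissible hv hsum'
    ⟨_, E, h.1, h.2, rfl⟩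
  obtain ⟨E₀, hE₀, hfin⟩ := exists_isConfig_nlPer_ne_top hd hK.1 b hv hsum'
  have hsumfin : ∑ i, nlPer K (E₀ i) ≠ ⊤ := ENNReal.sum_ne_top.2 fun i _ => hfin i
  have hDfin : nlPer K (⋃ i, E₀ i) ≠ ⊤ := by
    refine ne_top_of_le_ne_top hsumfin ?_
    exact (nlPer_iUnion_le hK.1.1 hE₀.measurable).trans_eq (tsum_fintype _)
  have htop : sInf S ≠ ⊤ := ne_top_of_le_ne_top
    (ENNReal.add_ne_top.2 ⟨ENNReal.mul_ne_top ENNReal.ofReal_ne_top hDfin,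
      ENNReal.mul_ne_top (by simp) hsumfin⟩) (sInf_le (hmem E₀ hE₀))
  refine ⟨htop, ?_⟩
  obtain ⟨c, -, hc, hcS⟩ := exists_seq_tendsto_sInf ⟨_, hmem E₀ hE₀⟩ (OrderBot.bddBelow S)
  have hrep : ∀ n, ∃ E : Fin N → Set (Vd d), IsConfig b v E ∧
      c n = ENNReal.ofReal μ * nlPer K (⋃ i, E i) + 2⁻¹ * ∑ i, nlPer K (E i) := by
    intro n
    obtain ⟨D, E, hD, hE, hcn⟩ := hcS n
    obtain ⟨E', hE', hae, haeD⟩ := exists_isConfig_of_admissible hD hE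
    refine ⟨E', hE', ?_⟩
    rw [hcn, nlPer_congr_ae K haeD, Finset.sum_congr rfl fun i _ => nlPer_congr_ae K (hae i)]
  choose E hE hcE using hrep
  rw [funext hcE] at hc
  obtain ⟨E', hE', hle⟩ := exists_isConfig_energy_le hs.1 hC hK hv hsum' ENNReal.ofReal_ne_top
    htop hE hc
  have h := hE'.isFundDom_and_admissible hv hsum'
  exact ⟨_, E', h.1, h.2, hle.antisymm (sInf_le (hmem E' hE'))⟩

end
end
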